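/- Let K be a field, f : ℕ → ℤ nonincreasing and g : ℕ → ℤ nondecreasing. Let H = ℤ[1/2] + ℤ[1/2]·√2 ⊆ ℝ, a subgroup of (ℝ,+). Then there exists a valuation ν of the rational function field K(x,y,u,v,z) with value group exactly H × ℤ, ordered lexicographically, dominating the regular local ring R = K[x,y,u,v,z]_{(x,y,u,v,z)}, with the following property: for every valuation ω of K(x,y,u,v,z), taking values in the lexicographically ordered group H × ℤ with ω(K(x,y,u,v,z)∖{0}) = H × ℤ, which is equivalent to ν (i.e. has the same valuation ring as ν), there exists n₀ ∈ ℕ such that for every integer n ≥ n₀ there exist λ₁, λ₂ ∈ ω₂(R∖{0}) with 0 ≤ λ₁ < n, 0 ≤ λ₂ < n, π₂(λ̃₁) < f(n) and π₂(λ̃₂) > g(n), where ω₂ = π₁∘ω, λ̃ = min{ω(h) : h ∈ R∖{0}, ω₂(h) = λ}, and π₁, π₂ are the first and second projections. -/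

import Mathlib

open MvPolynomial

/-- The subgroup `H = ℤ[1/2] + ℤ[1/2]·√2` of `(ℝ,+)`, as a set. -/
noncomputable def dyadicSqrt2Set : Set ℝ :=
  {r : ℝ | ∃ (a b : ℤ) (k l : ℕ),
    r = (a : ℝ) / 2 ^ k + ((b : ℝ) / 2 ^ l) * Real.sqrt 2}

/-- The maximal ideal `(x,y,u,v,z)` of `K[x,y,u,v,z]`. -/
noncomputable def mxyuvz (K : Type*) [Field K] : Ideal (MvPolynomial (Fin 5) K) :=
  Ideal.span {X 0, X 1, X 2, X 3, X 4}

/-- The local ring `R = K[x,y,u,v,z]_{(x,y,u,v,z)}`, realized as the subset of the rational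
function field `K(x,y,u,v,z)` of elements of the form `f/g` with `g ∉ (x,y,u,v,z)`. -/
noncomputable def Rxyuvz (K : Type*) [Field K] : Set (FractionRing (MvPolynomial (Fin 5) K)) :=
  {x | ∃ f g : MvPolynomial (Fin 5) K, g ∉ mxyuvz K ∧
    x * algebraMap (MvPolynomial (Fin 5) K) (FractionRing (MvPolynomial (Fin 5) K)) g
      = algebraMap (MvPolynomial (Fin 5) K) (FractionRing (MvPolynomial (Fin 5) K)) f}

/-- The maximal ideal of `R = K[x,y,u,v,z]_{(x,y,u,v,z)}`, as a subset of `K(x,y,u,v,z)`. -/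
noncomputable def mRxyuvz (K : Type*) [Field K] :
    Set (FractionRing (MvPolynomial (Fin 5) K)) :=
  {x | ∃ f g : MvPolynomial (Fin 5) K, f ∈ mxyuvz K ∧ g ∉ mxyuvz K ∧
    x * algebraMap (MvPolynomial (Fin 5) K) (FractionRing (MvPolynomial (Fin 5) K)) g
      = algebraMap (MvPolynomial (Fin 5) K) (FractionRing (MvPolynomial (Fin 5) K)) f}

namespace WildValuation

/-- The lexicographically ordered group `ℝ × ℤ`. -/
abbrev LexGroup : Type := ℝ ×ₗ ℤ

/-- The element `(r, k)` of the lexicographically ordered group `ℝ × ℤ`. -/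
def lexPair (r : ℝ) (k : ℤ) : LexGroup := toLex (r, k)

@[simp] lemma fst_lexPair (r : ℝ) (k : ℤ) : (ofLex (lexPair r k)).1 = r := rfl

@[simp] lemma snd_lexPair (r : ℝ) (k : ℤ) : (ofLex (lexPair r k)).2 = k := rfl

lemma lexPair_eta (γ : LexGroup) : lexPair (ofLex γ).1 (ofLex γ).2 = γ := rfl

lemma lexPair_add (r s : ℝ) (k l : ℤ) :
    lexPair r k + lexPair s l = lexPair (r + s) (k + l) := rfl

@[simp] lemma fst_add (γ δ : LexGroup) : (ofLex (γ + δ)).1 = (ofLex γ).1 + (ofLex δ).1 := rfl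

@[simp] lemma snd_add (γ δ : LexGroup) : (ofLex (γ + δ)).2 = (ofLex γ).2 + (ofLex δ).2 := rfl

@[simp] lemma fst_sub (γ δ : LexGroup) : (ofLex (γ - δ)).1 = (ofLex γ).1 - (ofLex δ).1 := rfl

@[simp] lemma snd_sub (γ δ : LexGroup) : (ofLex (γ - δ)).2 = (ofLex γ).2 - (ofLex δ).2 := rfl

@[simp] lemma fst_neg (γ : LexGroup) : (ofLex (-γ)).1 = -(ofLex γ).1 := rfl

@[simp] lemma snd_neg (γ : LexGroup) : (ofLex (-γ)).2 = -(ofLex γ).2 := rfl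

@[simp] lemma fst_zero : (ofLex (0 : LexGroup)).1 = 0 := rfl

@[simp] lemma snd_zero : (ofLex (0 : LexGroup)).2 = 0 := rfl

@[simp] lemma fst_nsmul (n : ℕ) (γ : LexGroup) : (ofLex (n • γ)).1 = n * (ofLex γ).1 := by
  simp

@[simp] lemma snd_nsmul (n : ℕ) (γ : LexGroup) : (ofLex (n • γ)).2 = n * (ofLex γ).2 := by
  simp

lemma lexPair_nsmul (n : ℕ) (r : ℝ) (k : ℤ) :
    n • lexPair r k = lexPair (n * r) (n * k) := by
  rw [← lexPair_eta (n • lexPair r k)]; simp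

lemma lex_lt_iff (γ δ : LexGroup) : γ < δ ↔ (ofLex γ).1 < (ofLex δ).1 ∨
    ((ofLex γ).1 = (ofLex δ).1 ∧ (ofLex γ).2 < (ofLex δ).2) := Prod.Lex.lt_iff

lemma lex_le_iff (γ δ : LexGroup) : γ ≤ δ ↔ (ofLex γ).1 < (ofLex δ).1 ∨
    ((ofLex γ).1 = (ofLex δ).1 ∧ (ofLex γ).2 ≤ (ofLex δ).2) := Prod.Lex.le_iff

lemma fst_le_of_le {γ δ : LexGroup} (h : γ ≤ δ) : (ofLex γ).1 ≤ (ofLex δ).1 := by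
  rcases (lex_le_iff _ _).1 h with h | h
  · exact h.le
  · exact h.1.le

lemma lt_of_fst_lt {γ δ : LexGroup} (h : (ofLex γ).1 < (ofLex δ).1) : γ < δ :=
  (lex_lt_iff _ _).2 (Or.inl h)

lemma lex_ext {γ δ : LexGroup} (h₁ : (ofLex γ).1 = (ofLex δ).1)
    (h₂ : (ofLex γ).2 = (ofLex δ).2) : γ = δ :=
  ofLex.injective (Prod.ext h₁ h₂)

section Hahn

variable {K : Type*} [Field K]

/-- The Hahn series whose support lies in a given additive submonoid. -/
def supportSubalgebra (K : Type*) [Field K] (T : AddSubmonoid LexGroup) :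
    Subalgebra K (HahnSeries LexGroup K) where
  carrier := {h | h.support ⊆ T}
  mul_mem' := by
    intro a b ha hb γ hγ
    obtain ⟨i, hi, j, hj, rfl⟩ := Set.mem_add.1 (HahnSeries.support_mul_subset hγ)
    exact T.add_mem (ha hi) (hb hj)
  add_mem' := by
    intro a b ha hb γ hγ
    rcases HahnSeries.support_add_subset a b hγ with h | h
    · exact ha h
    · exact hb h
  algebraMap_mem' := by
    intro r γ hγ
    rw [HahnSeries.algebraMap_apply] at hγ
    have : γ = 0 := HahnSeries.eq_of_mem_support_single hγ
    rw [this]; exact T.zero_mem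

lemma order_mem_of_mem_supportSubalgebra {T : AddSubmonoid LexGroup}
    {h : HahnSeries LexGroup K} (hh : h ∈ supportSubalgebra K T) (h0 : h ≠ 0) :
    h.order ∈ T := by
  apply hh
  rw [HahnSeries.mem_support]
  exact fun h' => h0 (HahnSeries.coeff_order_eq_zero.1 h')

lemma sum_order_eq {ι : Type*} (s : Finset ι) (f : ι → HahnSeries LexGroup K) (i₀ : ι)
    (hi₀ : i₀ ∈ s) (h0 : f i₀ ≠ 0)
    (h : ∀ i ∈ s, i ≠ i₀ → f i ≠ 0 → (f i₀).order < (f i).order) :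
    ∑ i ∈ s, f i ≠ 0 ∧ (∑ i ∈ s, f i).order = (f i₀).order := by
  have key : (∑ i ∈ s, f i).coeff (f i₀).order = (f i₀).coeff (f i₀).order := by
    rw [HahnSeries.coeff_sum]
    refine Finset.sum_eq_single_of_mem _ hi₀ fun i hi hne => ?_
    by_cases hz : f i = 0
    · simp [hz]
    · exact HahnSeries.coeff_eq_zero_of_lt_order (h i hi hne hz)
  have hc : (f i₀).coeff (f i₀).order ≠ 0 := fun h' => h0 (HahnSeries.coeff_order_eq_zero.1 h')
  have hne : ∑ i ∈ s, f i ≠ 0 := by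
    intro hz
    rw [hz] at key
    exact hc key.symm
  refine ⟨hne, le_antisymm (HahnSeries.order_le_of_coeff_ne_zero (key ▸ hc)) ?_⟩
  rw [HahnSeries.le_order_iff_forall hne]
  intro δ hδ
  rw [HahnSeries.coeff_sum]
  refine Finset.sum_eq_zero fun i hi => ?_
  by_cases hz : f i = 0
  · simp [hz]
  · apply HahnSeries.coeff_eq_zero_of_lt_order
    by_cases hii : i = i₀
    · rwa [hii]
    · exact hδ.trans (h i hi hii hz)

lemma sum_ne_zero_of_injOn_order {ι : Type*} (s : Finset ι) (hs : s.Nonempty)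
    (f : ι → HahnSeries LexGroup K) (h0 : ∀ i ∈ s, f i ≠ 0)
    (hinj : Set.InjOn (fun i => (f i).order) s) : ∑ i ∈ s, f i ≠ 0 := by
  obtain ⟨i₀, hi₀, hmin⟩ := s.exists_min_image (fun i => (f i).order) hs
  refine (sum_order_eq s f i₀ hi₀ (h0 _ hi₀) fun i hi hne _ => ?_).1
  exact lt_of_le_of_ne (hmin i hi) fun h => hne (hinj hi hi₀ h.symm)

lemma order_div {a b : HahnSeries LexGroup K} (ha : a ≠ 0) (hb : b ≠ 0) :
    (a / b).order = a.order - b.order := by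
  have : (a / b * b).order = (a / b).order + b.order :=
    HahnSeries.order_mul (div_ne_zero ha hb) hb
  rw [div_mul_cancel₀ _ hb] at this
  rw [this, add_sub_cancel_right]

lemma transcendental_of_order (S : Set (HahnSeries LexGroup K)) (Λ : AddSubgroup LexGroup)
    (hA : ∀ a ∈ Algebra.adjoin K S, a ≠ 0 → a.order ∈ Λ) (t : HahnSeries LexGroup K)
    (Q : ℕ → HahnSeries LexGroup K)
    (hQ : ∀ j, Q j ∈ Algebra.adjoin K (insert t S)) (hQ0 : ∀ j, Q j ≠ 0)
    (hne : ∀ i j, i < j → (Q j).order - (Q i).order ∉ Λ) :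
    Transcendental (Algebra.adjoin K S) t := by
  intro halg
  set E := IntermediateField.adjoin K S
  have hE : ∀ a ∈ E, a ≠ 0 → a.order ∈ Λ := by
    intro a ha ha0
    obtain ⟨r, hr, s, hs, rfl⟩ := IntermediateField.mem_adjoin_iff_div.1 ha
    have hr0 : r ≠ 0 := by rintro rfl; simp at ha0
    have hs0 : s ≠ 0 := by rintro rfl; simp at ha0
    rw [order_div hr0 hs0]
    exact Λ.sub_mem (hA r hr hr0) (hA s hs hs0)
  have halgE : IsAlgebraic E t := by
    obtain ⟨p, hp0, hp⟩ := halg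
    have hle : Algebra.adjoin K S ≤ E.toSubalgebra := IntermediateField.algebra_adjoin_le_adjoin K S
    refine ⟨p.map (Subalgebra.inclusion hle).toRingHom, ?_, ?_⟩
    · rw [Polynomial.map_ne_zero_iff]
      · exact hp0
      · exact Subalgebra.inclusion_injective hle
    · rw [Polynomial.aeval_def, Polynomial.eval₂_map]
      exact hp
  have hfin : FiniteDimensional E (IntermediateField.adjoin E {t}) :=
    IntermediateField.adjoin.finiteDimensional halgE.isIntegral
  have hmem : ∀ j, Q j ∈ IntermediateField.adjoin E {t} := by
    intro j
    have : Algebra.adjoin K (insert t S) ≤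
        ((IntermediateField.adjoin E {t}).restrictScalars K).toSubalgebra := by
      rw [Algebra.adjoin_le_iff]
      rintro a (rfl | ha)
      · exact IntermediateField.mem_adjoin_simple_self E a
      · exact (IntermediateField.adjoin E {t}).algebraMap_mem
          ⟨a, IntermediateField.subset_adjoin K S ha⟩
    exact this (hQ j)
  have hli : LinearIndependent E (fun j => (⟨Q j, hmem j⟩ : IntermediateField.adjoin E {t})) := by
    rw [linearIndependent_iff']
    intro s c hc
    by_contra hcon
    push Not at hcon
    classical
    let s' := s.filter (fun i => c i ≠ 0)
    have hc' : ∑ i ∈ s', (c i : HahnSeries LexGroup K) * Q i = 0 := by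
      have h1 := congrArg (fun w : IntermediateField.adjoin E {t} => (w : HahnSeries LexGroup K)) hc
      simp only [AddSubmonoidClass.coe_finsetSum, ZeroMemClass.coe_zero] at h1
      rw [Finset.sum_filter_of_ne]
      · rw [← h1]
        exact Finset.sum_congr rfl fun i _ => rfl
      · intro i _ h h'
        apply h
        rw [h']; simp
    refine sum_ne_zero_of_injOn_order s' ?_ _ ?_ ?_ hc'
    · obtain ⟨i, hi, hi'⟩ := hcon
      exact ⟨i, Finset.mem_filter.2 ⟨hi, hi'⟩⟩
    · intro i hi
      have : (c i : HahnSeries LexGroup K) ≠ 0 := by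
        simpa using (Finset.mem_filter.1 hi).2
      exact mul_ne_zero this (hQ0 i)
    · have aux : ∀ i j, c i ≠ 0 → c j ≠ 0 → i < j →
          ((c i : HahnSeries LexGroup K) * Q i).order ≠
            ((c j : HahnSeries LexGroup K) * Q j).order := by
        intro i j hi hj hij heq
        have hi' : (c i : HahnSeries LexGroup K) ≠ 0 := by simpa using hi
        have hj' : (c j : HahnSeries LexGroup K) ≠ 0 := by simpa using hj
        rw [HahnSeries.order_mul hi' (hQ0 i), HahnSeries.order_mul hj' (hQ0 j)] at heq
        apply hne i j hij
        have : (Q j).order - (Q i).order = (c i : HahnSeries LexGroup K).order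
            - (c j : HahnSeries LexGroup K).order := by
          rw [sub_eq_sub_iff_add_eq_add, add_comm, ← heq, add_comm]
        rw [this]
        exact Λ.sub_mem (hE _ (c i).2 hi') (hE _ (c j).2 hj')
      intro i hi j hj hij
      have hi' := (Finset.mem_filter.1 hi).2
      have hj' := (Finset.mem_filter.1 hj).2
      rcases lt_trichotomy i j with h | h | h
      · exact (aux i j hi' hj' h hij).elim
      · exact h
      · exact (aux j i hj' hi' h hij.symm).elim
  exact not_finite_iff_infinite.2 (inferInstance : Infinite ℕ) hli.finite

/-- The Hahn monomial `t ^ (r, k)`. -/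
noncomputable def mono (K : Type*) [Field K] (r : ℝ) (k : ℤ) : HahnSeries LexGroup K :=
  HahnSeries.single (lexPair r k) 1

lemma mono_ne_zero (r : ℝ) (k : ℤ) : mono K r k ≠ 0 := HahnSeries.single_ne_zero one_ne_zero

lemma order_mono (r : ℝ) (k : ℤ) : (mono K r k).order = lexPair r k :=
  HahnSeries.order_single one_ne_zero

lemma mono_mul (r s : ℝ) (k l : ℤ) : mono K r k * mono K s l = mono K (r + s) (k + l) := by
  rw [mono, mono, HahnSeries.single_mul_single, one_mul, lexPair_add, mono]

lemma mono_pow (r : ℝ) (k : ℤ) (n : ℕ) : mono K r k ^ n = mono K (n * r) (n * k) := by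
  rw [mono, HahnSeries.single_pow, one_pow, lexPair_nsmul, mono]

/-- Hahn series supported in the box `θ / q * {0, …, N} × [lo, hi]`. -/
def boxed (K : Type*) [Field K] (θ : ℝ) (q N : ℕ) (lo hi : ℤ) :
    Submodule K (HahnSeries LexGroup K) where
  carrier := {h | ∀ γ ∈ h.support, (∃ i : ℕ, i ≤ N ∧ (ofLex γ).1 = θ * (i / q)) ∧
    lo ≤ (ofLex γ).2 ∧ (ofLex γ).2 ≤ hi}
  add_mem' := by
    intro a b ha hb γ hγ
    rcases HahnSeries.support_add_subset a b hγ with h | h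
    · exact ha _ h
    · exact hb _ h
  zero_mem' := by intro γ hγ; simp at hγ
  smul_mem' := by
    intro c a ha γ hγ
    exact ha _ (HahnSeries.support_smul_subset c a hγ)

lemma boxed_mul {θ : ℝ} {q N N' : ℕ} {lo hi lo' hi' : ℤ} {a b : HahnSeries LexGroup K}
    (ha : a ∈ boxed K θ q N lo hi) (hb : b ∈ boxed K θ q N' lo' hi') :
    a * b ∈ boxed K θ q (N + N') (lo + lo') (hi + hi') := by
  intro γ hγ
  obtain ⟨γ₁, h₁, γ₂, h₂, rfl⟩ := Set.mem_add.1 (HahnSeries.support_mul_subset hγ)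
  obtain ⟨⟨i, hi, hi'⟩, h3, h4⟩ := ha _ h₁
  obtain ⟨⟨j, hj, hj'⟩, h5, h6⟩ := hb _ h₂
  refine ⟨⟨i + j, by omega, ?_⟩, ?_, ?_⟩
  · rw [fst_add, hi', hj']; push_cast; ring
  · rw [snd_add]; omega
  · rw [snd_add]; omega

lemma boxed_mono {θ : ℝ} {q N N' : ℕ} {lo hi lo' hi' : ℤ} (h₁ : N ≤ N') (h₂ : lo' ≤ lo)
    (h₃ : hi ≤ hi') : boxed K θ q N lo hi ≤ boxed K θ q N' lo' hi' := by
  intro a ha γ hγ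
  obtain ⟨⟨i, hi, hi'⟩, h3, h4⟩ := ha _ hγ
  exact ⟨⟨i, by omega, hi'⟩, by omega, by omega⟩

lemma mono_mem_boxed {θ r : ℝ} {q N : ℕ} {lo hi k : ℤ} (hr : ∃ i : ℕ, i ≤ N ∧ r = θ * (i / q))
    (h₁ : lo ≤ k) (h₂ : k ≤ hi) : mono K r k ∈ boxed K θ q N lo hi := by
  intro γ hγ
  have : γ = lexPair r k := HahnSeries.eq_of_mem_support_single hγ
  subst this
  exact ⟨hr, h₁, h₂⟩

lemma boxed_pow {θ : ℝ} {q N : ℕ} {lo hi : ℤ} {a : HahnSeries LexGroup K}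
    (ha : a ∈ boxed K θ q N lo hi) (n : ℕ) :
    a ^ n ∈ boxed K θ q (n * N) (n * lo) (n * hi) := by
  induction n with
  | zero =>
    rw [pow_zero]
    have : (1 : HahnSeries LexGroup K) = mono K 0 0 := rfl
    rw [this]
    exact mono_mem_boxed ⟨0, by simp⟩ (by simp) (by simp)
  | succ n ih =>
    rw [pow_succ]
    convert boxed_mul ih ha using 1
    push_cast
    ring_nf

/-- An algebraic relation of controlled degree between a finite sum of monomials and
`t ^ (θ, 0)`, `t ^ (0, 1)`. -/
lemma exists_relation {θ : ℝ} (hθ : 0 < θ) {q d : ℕ} (hq : 0 < q) (p : HahnSeries LexGroup K)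
    (E : ℕ) (hp : p ∈ boxed K θ q d (-E) E) :
    ∃ (C : ℕ) (κ : Fin (q * d + 1) × Fin (q + 1) × Fin (C + 1) → K), κ ≠ 0 ∧
      ∑ j, κ j • (mono K θ 0 ^ (j.1 : ℕ) * mono K 0 1 ^ (j.2.2 : ℕ) * p ^ (j.2.1 : ℕ)) = 0 := by
  set N := q * (q * d) + q * d with hN
  set C := (N + 1) * (2 * q * E) with hC
  let L : (Fin (q * d + 1) × Fin (q + 1) × Fin (C + 1) → K) →ₗ[K] HahnSeries LexGroup K :=
    Fintype.linearCombination K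
      (fun j => mono K θ 0 ^ (j.1 : ℕ) * mono K 0 1 ^ (j.2.2 : ℕ) * p ^ (j.2.1 : ℕ))
  have hL : ∀ κ, L κ ∈ boxed K θ q N (-(q * E : ℕ)) ((C + q * E : ℕ) : ℤ) := by
    intro κ
    rw [Fintype.linearCombination_apply]
    refine Submodule.sum_mem _ fun j _ => Submodule.smul_mem _ _ ?_
    have h1 : mono K θ 0 ^ (j.1 : ℕ) ∈ boxed K θ q (q * j.1) 0 0 := by
      rw [mono_pow]
      refine mono_mem_boxed ⟨q * j.1, le_rfl, ?_⟩ (by simp) (by simp)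
      push_cast; field_simp
    have h2 : mono K 0 1 ^ (j.2.2 : ℕ) ∈ boxed K θ q 0 0 C := by
      rw [mono_pow]
      refine mono_mem_boxed ⟨0, le_rfl, by simp⟩ (by simp) ?_
      have := j.2.2.2; omega
    have h3 := boxed_pow hp (j.2.1 : ℕ)
    have hj1 : (j.1 : ℕ) ≤ q * d := Nat.lt_succ_iff.1 j.1.2
    have hj2 : (j.2.1 : ℕ) ≤ q := Nat.lt_succ_iff.1 j.2.1.2
    refine boxed_mono ?_ ?_ ?_ (boxed_mul (boxed_mul h1 h2) h3)
    · have := Nat.mul_le_mul_left q hj1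
      have := Nat.mul_le_mul_right d hj2
      omega
    · have := Nat.mul_le_mul_right E hj2
      push_cast
      zify at this
      linarith
    · have := Nat.mul_le_mul_right E hj2
      push_cast
      zify at this
      linarith
  let M : (Fin (q * d + 1) × Fin (q + 1) × Fin (C + 1) → K) →ₗ[K]
      (Fin (N + 1) × Fin (C + 2 * q * E + 1) → K) :=
    { toFun := fun κ i => (L κ).coeff (lexPair (θ * ((i.1 : ℕ) / q)) ((i.2 : ℕ) - (q * E : ℕ)))
      map_add' := by intro a b; ext i; simp
      map_smul' := by intro c a; ext i; simp }
  have hcard : Module.finrank K (Fin (N + 1) × Fin (C + 2 * q * E + 1) → K) <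
      Module.finrank K (Fin (q * d + 1) × Fin (q + 1) × Fin (C + 1) → K) := by
    rw [Module.finrank_fintype_fun_eq_card, Module.finrank_fintype_fun_eq_card]
    simp only [Fintype.card_prod, Fintype.card_fin]
    have e1 : (q * d + 1) * ((q + 1) * (C + 1)) = (N + 1) * (C + 1) + q * (C + 1) := by
      rw [hN]; ring
    have e2 : (N + 1) * (C + 2 * q * E + 1) = (N + 1) * (C + 1) + C := by
      conv_rhs => rw [hC]
      conv_lhs => rw [hC]
      ring
    rw [e1, e2]
    nlinarith
  have hker := LinearMap.ker_ne_bot_of_finrank_lt (f := M) hcard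
  obtain ⟨κ, hκ, hκ0⟩ := Submodule.exists_mem_ne_zero_of_ne_bot hker
  refine ⟨C, κ, hκ0, ?_⟩
  change L κ = 0
  rw [← HahnSeries.support_eq_empty_iff]
  refine Set.eq_empty_of_forall_notMem fun γ hγ => hγ ?_
  obtain ⟨⟨i, hi, hi'⟩, h1, h2⟩ := hL κ γ hγ
  have h3 := congrFun (LinearMap.mem_ker.1 hκ)
    (⟨i, by omega⟩, ⟨((ofLex γ).2 + (q * E : ℕ)).toNat, by
      push_cast at h1 h2 ⊢
      zify
      rw [Int.toNat_of_nonneg (by linarith)]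
      linarith⟩)
  have h4 : lexPair (θ * ((i : ℕ) / q))
      ((((ofLex γ).2 + (q * E : ℕ)).toNat : ℤ) - (q * E : ℕ)) = γ := by
    apply lex_ext
    · rw [fst_lexPair, hi']
    · rw [snd_lexPair, Int.toNat_of_nonneg (by linarith)]; ring
  have h5 : (L κ).coeff (lexPair (θ * ((i : ℕ) / q))
      ((((ofLex γ).2 + (q * E : ℕ)).toNat : ℤ) - (q * E : ℕ))) = 0 := h3
  rwa [h4] at h5

open Polynomial in
/-- For a finite sum of monomials `p` there is a polynomial vanishing at `p` whose order at a small
enough perturbation `p + ε` is controlled by that of `ε`. -/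
lemma exists_key_polynomial {θ : ℝ} (hθ : 0 < θ) {q d : ℕ} (hq : 0 < q)
    (p : HahnSeries LexGroup K) (E : ℕ) (hp : p ∈ boxed K θ q d (-E) E) :
    ∃ (P : MvPolynomial (Fin 3) K) (k i : ℕ) (c : ℤ), 1 ≤ k ∧ k ≤ q ∧ i ≤ q * (q * d) + q * d ∧
      ∀ ε : HahnSeries LexGroup K, ε ≠ 0 →
        θ * ((q * (q * d) + q * d : ℕ) / q) < (ofLex ε.order).1 →
        MvPolynomial.aeval ![mono K θ 0, p + ε, mono K 0 1] P ≠ 0 ∧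
        (MvPolynomial.aeval ![mono K θ 0, p + ε, mono K 0 1] P).order =
          lexPair (θ * (i / q)) c + k • ε.order := by
  obtain ⟨C', κ, hκ0, hκ⟩ := exists_relation hθ hq p E hp
  set N := q * (q * d) + q * d with hN
  let m : Fin (q * d + 1) × Fin (q + 1) × Fin (C' + 1) → HahnSeries LexGroup K :=
    fun j => κ j • (mono K θ 0 ^ (j.1 : ℕ) * mono K 0 1 ^ (j.2.2 : ℕ))
  let Q : (HahnSeries LexGroup K)[X] := ∑ j, Polynomial.C (m j) * Polynomial.X ^ (j.2.1 : ℕ)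
  let P : MvPolynomial (Fin 3) K := ∑ j, κ j • (MvPolynomial.X 0 ^ (j.1 : ℕ) *
    MvPolynomial.X 2 ^ (j.2.2 : ℕ) * MvPolynomial.X 1 ^ (j.2.1 : ℕ))
  have hPQ : ∀ t, MvPolynomial.aeval ![mono K θ 0, t, mono K 0 1] P = Q.eval t := by
    intro t
    simp [P, Q, m, eval_finsetSum]
  have hm : ∀ j, m j = HahnSeries.single (lexPair (θ * (j.1 : ℕ)) (j.2.2 : ℕ)) (κ j) := by
    intro j
    simp only [m, mono_pow, mono_mul]
    ext γ
    simp [mono, HahnSeries.coeff_single, mul_comm]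
  have hQ0 : Q ≠ 0 := by
    obtain ⟨j₀, hj₀⟩ := Function.ne_iff.1 hκ0
    intro hQ
    apply hj₀
    have h1 : (Q.coeff (j₀.2.1 : ℕ)).coeff (lexPair (θ * (j₀.1 : ℕ)) (j₀.2.2 : ℕ)) = κ j₀ := by
      simp only [Q, finsetSum_coeff, Polynomial.coeff_C_mul, Polynomial.coeff_X_pow,
        HahnSeries.coeff_sum]
      rw [Finset.sum_eq_single j₀]
      · simp [hm]
      · intro j _ hj
        by_cases h : (j₀.2.1 : ℕ) = (j.2.1 : ℕ)
        · rw [if_pos h, mul_one, hm, HahnSeries.coeff_single_of_ne]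
          intro h'
          apply hj
          have h2 := congrArg (fun γ => (ofLex γ).1) h'
          have h3 := congrArg (fun γ => (ofLex γ).2) h'
          simp only [fst_lexPair, snd_lexPair, mul_eq_mul_left_iff, hθ.ne', or_false,
            Nat.cast_inj] at h2 h3
          refine Prod.ext (Fin.ext h2.symm) (Prod.ext (Fin.ext h.symm) (Fin.ext h3.symm))
        · rw [if_neg h, mul_zero]; rfl
      · simp
    rw [← h1, hQ]; simp
  set T := taylor p Q with hT
  have hT0 : T ≠ 0 := by
    rw [hT, Ne, taylor_eq_zero]; exact hQ0
  have hTc0 : T.coeff 0 = 0 := by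
    rw [hT, taylor_coeff_zero]
    rw [← hκ]
    simp [Q, m, eval_finsetSum]
  have hQdeg : Q.natDegree ≤ q := by
    refine natDegree_sum_le_of_forall_le _ _ fun j _ => ?_
    exact (natDegree_C_mul_X_pow_le _ _).trans (Nat.lt_succ_iff.1 j.2.1.2)
  have hTdeg : T.natDegree ≤ q := by rw [hT, natDegree_taylor]; exact hQdeg
  have hTbox : ∀ k, T.coeff k ∈ boxed K θ q N (-(q * E : ℕ)) ((C' + q * E : ℕ) : ℤ) := by
    intro k
    have : T.coeff k = ∑ j, ((j.2.1 : ℕ).choose k) • (m j * p ^ ((j.2.1 : ℕ) - k)) := by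
      simp only [hT, Q, map_sum, finsetSum_coeff]
      refine Finset.sum_congr rfl fun j _ => ?_
      rw [taylor_mul, taylor_C, taylor_X_pow, Polynomial.coeff_C_mul, coeff_X_add_C_pow,
        nsmul_eq_mul]
      ring
    rw [this]
    refine Submodule.sum_mem _ fun j _ => Submodule.smul_of_tower_mem _ _ ?_
    have h1 : m j ∈ boxed K θ q (q * j.1) 0 C' := by
      refine Submodule.smul_mem _ _ ?_
      rw [mono_pow, mono_pow, mono_mul]
      refine mono_mem_boxed ⟨q * j.1, le_rfl, ?_⟩ (by simp) ?_
      · push_cast; field_simp; ring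
      · have := j.2.2.2; simp; omega
    have h3 := boxed_pow hp ((j.2.1 : ℕ) - k)
    have hj1 : (j.1 : ℕ) ≤ q * d := Nat.lt_succ_iff.1 j.1.2
    have hj2 : (j.2.1 : ℕ) - k ≤ q := by have := j.2.1.2; omega
    refine boxed_mono ?_ ?_ ?_ (boxed_mul h1 h3)
    · have := Nat.mul_le_mul_left q hj1
      have := Nat.mul_le_mul_right d hj2
      omega
    · have := Nat.mul_le_mul_right E hj2
      push_cast
      zify at this
      linarith
    · have := Nat.mul_le_mul_right E hj2
      push_cast
      zify at this
      linarith
  set k := T.natTrailingDegree with hk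
  have hTk : T.coeff k ≠ 0 := by
    rw [hk]; exact (trailingCoeff_nonzero_iff_nonzero).2 hT0
  have hord : ∀ l, T.coeff l ≠ 0 →
      ∃ i : ℕ, i ≤ N ∧ (ofLex (T.coeff l).order).1 = θ * (i / q) := by
    intro l hl
    refine (hTbox l (T.coeff l).order ?_).1
    rw [HahnSeries.mem_support]
    exact fun h' => hl (HahnSeries.coeff_order_eq_zero.1 h')
  obtain ⟨i, hi, hi'⟩ := hord k hTk
  have hq' : (0 : ℝ) < q := Nat.cast_pos.2 hq
  refine ⟨P, k, i, (ofLex (T.coeff k).order).2, ?_, ?_, hi, ?_⟩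
  · rw [Nat.one_le_iff_ne_zero]
    intro h; rw [h] at hTk; exact hTk hTc0
  · exact (natTrailingDegree_le_natDegree T).trans hTdeg
  · intro ε hε hbig
    rw [hPQ]
    have hev : Q.eval (p + ε) = ∑ l ∈ Finset.range (T.natDegree + 1), T.coeff l * ε ^ l := by
      rw [← eval_eq_sum_range, hT, taylor_eval, add_comm]
    have hmain := sum_order_eq (Finset.range (T.natDegree + 1)) (fun l => T.coeff l * ε ^ l) k
      (Finset.mem_range.2 (Nat.lt_succ_iff.2 (natTrailingDegree_le_natDegree T)))
      (mul_ne_zero hTk (pow_ne_zero _ hε)) ?_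
    · rw [hev]
      refine ⟨hmain.1, hmain.2.trans ?_⟩
      rw [HahnSeries.order_mul hTk (pow_ne_zero _ hε), HahnSeries.order_pow, ← hi', lexPair_eta]
    · intro l _ hl hne
      have hl0 : T.coeff l ≠ 0 := left_ne_zero_of_mul hne
      have hkl : k < l := lt_of_le_of_ne (natTrailingDegree_le_of_ne_zero hl0) hl.symm
      apply lt_of_fst_lt
      rw [HahnSeries.order_mul hTk (pow_ne_zero _ hε), HahnSeries.order_pow,
        HahnSeries.order_mul hl0 (pow_ne_zero _ hε), HahnSeries.order_pow]
      simp only [fst_add, fst_nsmul]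
      obtain ⟨i', hi1, hi2⟩ := hord l hl0
      rw [hi2, hi']
      have h1 : θ * ((i : ℝ) / q) ≤ θ * ((N : ℕ) / q) := by
        have : (i : ℝ) ≤ N := by exact_mod_cast hi
        gcongr
      have h2 : 0 ≤ θ * ((i' : ℝ) / q) := by positivity
      have h3 : (k : ℝ) + 1 ≤ l := by exact_mod_cast hkl
      have h4 : 0 ≤ θ * ((i : ℝ) / q) := by positivity
      nlinarith

end Hahn

/-- The denominators `1, 2, 8, 128, …` used in the construction. -/
def denom : ℕ → ℕ
  | 0 => 1
  | j + 1 => 2 * denom j ^ 2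

/-- An integral bound for the first `j` exponents. -/
def expBound : ℕ → ℕ
  | 0 => 0
  | j + 1 => denom j * (denom j * expBound j) + denom j * expBound j + 2

/-- A bound for the gap needed before the `j`-th exponent. -/
def gapBound (j : ℕ) : ℕ := denom j * (denom j * expBound j) + denom j * expBound j

/-- The exponents of the two transcendental series. -/
noncomputable def expo (j : ℕ) : ℝ := gapBound j + 1 + 1 / denom (j + 1)

/-- A bound for the values of the `j`-th key polynomials. -/
def valueBound (j : ℕ) : ℕ := 2 * (gapBound j + denom j * expBound (j + 1)) + j + 1

lemma denom_succ (j : ℕ) : denom (j + 1) = 2 * denom j ^ 2 := rfl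

lemma expBound_succ (j : ℕ) : expBound (j + 1) = gapBound j + 2 := rfl

lemma denom_pos (j : ℕ) : 0 < denom j := by
  induction j with
  | zero => simp [denom]
  | succ j ih => rw [denom_succ]; positivity

lemma denom_eq_two_pow (j : ℕ) : ∃ r, j ≤ r ∧ denom j = 2 ^ r := by
  induction j with
  | zero => exact ⟨0, le_rfl, rfl⟩
  | succ j ih =>
    obtain ⟨r, hr, h⟩ := ih
    exact ⟨2 * r + 1, by omega, by rw [denom_succ, h]; ring⟩

lemma denom_dvd_succ (j : ℕ) : denom j ∣ denom (j + 1) :=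
  ⟨2 * denom j, by rw [denom_succ]; ring⟩

lemma denom_dvd {i j : ℕ} (h : i ≤ j) : denom i ∣ denom j := by
  induction h with
  | refl => exact dvd_rfl
  | step _ ih => exact ih.trans (denom_dvd_succ _)

lemma expBound_le_gapBound (j : ℕ) : expBound j ≤ gapBound j := by
  have := denom_pos j
  unfold gapBound
  nlinarith [Nat.zero_le (expBound j), Nat.zero_le (denom j * (denom j * expBound j))]

lemma expBound_mono : Monotone expBound :=
  monotone_nat_of_le_succ fun j => by
    rw [expBound_succ]; have := expBound_le_gapBound j; omega

lemma denom_mono : Monotone denom :=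
  monotone_nat_of_le_succ fun j => Nat.le_of_dvd (denom_pos _) (denom_dvd_succ j)

lemma gapBound_mono : Monotone gapBound := by
  intro i j h
  have h1 := expBound_mono h
  have h2 := denom_mono h
  unfold gapBound
  gcongr

lemma valueBound_mono : Monotone valueBound := by
  intro i j h
  have h1 := expBound_mono (Nat.succ_le_succ h)
  have h2 := denom_mono h
  have h3 := gapBound_mono h
  unfold valueBound
  gcongr

lemma lt_valueBound (j : ℕ) : j < valueBound j := by unfold valueBound; omega

lemma denom_cast_pos (j : ℕ) : (0 : ℝ) < denom j := Nat.cast_pos.2 (denom_pos j)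

lemma expo_le (j : ℕ) : expo j ≤ expBound (j + 1) := by
  rw [expBound_succ, expo]
  have h1 : (1 : ℝ) ≤ denom (j + 1) := by exact_mod_cast denom_pos (j + 1)
  have : 1 / (denom (j + 1) : ℝ) ≤ 1 := by
    rw [div_le_one (denom_cast_pos _)]; exact h1
  push_cast; linarith

lemma gapBound_lt_expo (j : ℕ) : (gapBound j : ℝ) < expo j := by
  have : 0 < 1 / (denom (j + 1) : ℝ) := one_div_pos.2 (denom_cast_pos _)
  unfold expo; linarith

lemma expo_pos (j : ℕ) : 0 < expo j := lt_of_le_of_lt (Nat.cast_nonneg _) (gapBound_lt_expo j)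

lemma expo_strictMono : StrictMono expo :=
  strictMono_nat_of_lt_succ fun j => (expo_le j).trans_lt <|
    lt_of_le_of_lt (by exact_mod_cast expBound_le_gapBound (j + 1)) (gapBound_lt_expo (j + 1))

lemma expo_eq_div {i j : ℕ} (h : i < j) :
    ∃ n : ℕ, n ≤ denom j * expBound j ∧ expo i = n / denom j := by
  obtain ⟨c, hc⟩ := denom_dvd (Nat.succ_le_of_lt h)
  have e : expo i = (((gapBound i + 1) * denom j + c : ℕ) : ℝ) / denom j := by
    have h1 := denom_cast_pos (i + 1)
    have h2 := denom_cast_pos j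
    rw [eq_div_iff h2.ne', expo]
    push_cast
    have h3 : (denom j : ℝ) = denom (i + 1) * c := by exact_mod_cast hc
    rw [h3]
    field_simp
  refine ⟨_, ?_, e⟩
  have h1 : expo i ≤ expBound j :=
    (expo_le i).trans (by exact_mod_cast expBound_mono (Nat.succ_le_of_lt h))
  rw [e, div_le_iff₀ (denom_cast_pos j)] at h1
  have : (gapBound i + 1) * denom j + c ≤ expBound j * denom j := by exact_mod_cast h1
  rwa [mul_comm (denom j) (expBound j)]

/-- The subgroup of real multiples of `1 / q`. -/
def grid (q : ℕ) : AddSubgroup ℝ where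
  carrier := {r | ∃ n : ℤ, r = n / q}
  zero_mem' := ⟨0, by simp⟩
  add_mem' := by
    rintro _ _ ⟨m, rfl⟩ ⟨n, rfl⟩
    exact ⟨m + n, by push_cast; ring⟩
  neg_mem' := by
    rintro _ ⟨m, rfl⟩
    exact ⟨-m, by push_cast; ring⟩

lemma grid_mono {q q' : ℕ} (hq' : 0 < q') (h : q ∣ q') : grid q ≤ grid q' := by
  rintro _ ⟨n, rfl⟩
  obtain ⟨c, rfl⟩ := h
  have hq : (q : ℝ) ≠ 0 := by rintro h; simp [Nat.cast_eq_zero.1 h] at hq'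
  have hc : (c : ℝ) ≠ 0 := by rintro h; simp [Nat.cast_eq_zero.1 h] at hq'
  refine ⟨n * c, ?_⟩
  push_cast; field_simp

lemma grid_denom_mono {i j : ℕ} (h : i ≤ j) : grid (denom i) ≤ grid (denom j) :=
  grid_mono (denom_pos j) (denom_dvd h)

/-- The subgroup of dyadic rationals in `ℝ`. -/
def dyadic : AddSubgroup ℝ where
  carrier := {r | ∃ k : ℕ, r ∈ grid (2 ^ k)}
  zero_mem' := ⟨0, zero_mem _⟩
  add_mem' := by
    rintro a b ⟨k, hk⟩ ⟨l, hl⟩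
    exact ⟨k + l, add_mem (grid_mono (by positivity) (pow_dvd_pow 2 (by omega)) hk)
      (grid_mono (by positivity) (pow_dvd_pow 2 (by omega)) hl)⟩
  neg_mem' := by
    rintro a ⟨k, hk⟩
    exact ⟨k, neg_mem hk⟩

lemma grid_denom_le_dyadic (j : ℕ) : grid (denom j) ≤ dyadic := by
  obtain ⟨r, -, h⟩ := denom_eq_two_pow j
  rw [h]
  exact fun a ha => ⟨r, ha⟩

lemma expo_mem_grid {i j : ℕ} (h : i < j) : expo i ∈ grid (denom j) := by
  obtain ⟨n, -, hn⟩ := expo_eq_div h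
  exact ⟨n, by rw [hn]; simp⟩

lemma exists_rat_of_mem_dyadic {r : ℝ} (h : r ∈ dyadic) : ∃ s : ℚ, r = s := by
  obtain ⟨k, n, rfl⟩ := h
  exact ⟨n / (2 ^ k : ℕ), by push_cast; rfl⟩

lemma eq_zero_of_dyadic_add_mul_sqrt_two {p q : ℝ} (hp : p ∈ dyadic) (hq : q ∈ dyadic)
    (h : p + q * Real.sqrt 2 = 0) : p = 0 ∧ q = 0 := by
  obtain ⟨p, rfl⟩ := exists_rat_of_mem_dyadic hp
  obtain ⟨q, rfl⟩ := exists_rat_of_mem_dyadic hq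
  have hq0 : q = 0 := by
    by_contra hq0
    refine irrational_sqrt_two ⟨-p / q, ?_⟩
    have : (q : ℝ) ≠ 0 := by exact_mod_cast hq0
    push_cast
    field_simp
    linarith
  subst hq0
  simpa using h

lemma dyadic_add_mul_sqrt_two_inj {p q p' q' : ℝ} (hp : p ∈ dyadic) (hq : q ∈ dyadic)
    (hp' : p' ∈ dyadic) (hq' : q' ∈ dyadic)
    (h : p + q * Real.sqrt 2 = p' + q' * Real.sqrt 2) : p = p' ∧ q = q' := by
  have := eq_zero_of_dyadic_add_mul_sqrt_two (sub_mem hp hp') (sub_mem hq hq') (by linarith)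
  exact ⟨sub_eq_zero.1 this.1, sub_eq_zero.1 this.2⟩

lemma mem_dyadicSqrt2Set {r : ℝ} : r ∈ dyadicSqrt2Set ↔
    ∃ p ∈ dyadic, ∃ q ∈ dyadic, r = p + q * Real.sqrt 2 := by
  constructor
  · rintro ⟨a, b, k, l, rfl⟩
    exact ⟨a / 2 ^ k, ⟨k, a, by push_cast; rfl⟩, b / 2 ^ l, ⟨l, b, by push_cast; rfl⟩, rfl⟩
  · rintro ⟨_, ⟨k, a, rfl⟩, _, ⟨l, b, rfl⟩, rfl⟩
    exact ⟨a, b, k, l, by push_cast; rfl⟩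

/-- The real number `r` has a denominator at level exactly `j + 1` and is below the bound. -/
structure IsLevel (j : ℕ) (r : ℝ) : Prop where
  nonneg : 0 ≤ r
  lt : 2 * r < valueBound j
  mem : r ∈ grid (denom (j + 1))
  notMem : r ∉ grid (denom j)

lemma isLevel_of_eq {j k i : ℕ} (hk : 1 ≤ k) (hk' : k ≤ denom j)
    (hi : i ≤ denom j * gapBound j) : IsLevel j (i / denom j + k * expo j) := by
  have hq := denom_cast_pos j
  have hk1 : (1 : ℝ) ≤ k := by exact_mod_cast hk
  have hk2 : (k : ℝ) ≤ denom j := by exact_mod_cast hk'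
  have hb := expo_pos j
  refine ⟨by positivity, ?_, ?_, ?_⟩
  · have h1 : (i : ℝ) / denom j ≤ gapBound j := by
      rw [div_le_iff₀ hq, mul_comm]; exact_mod_cast hi
    have h2 : k * expo j ≤ denom j * expBound (j + 1) := by
      have := expo_le j
      gcongr
    rw [valueBound]; push_cast
    have : (0 : ℝ) ≤ j := Nat.cast_nonneg j
    linarith
  · have hi' : (i : ℝ) / denom j ∈ grid (denom j) := ⟨i, by simp⟩
    have hi'' : (i : ℝ) / denom j ∈ grid (denom (j + 1)) := grid_denom_mono (Nat.le_succ j) hi'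
    refine add_mem hi'' ?_
    have := nsmul_mem (expo_mem_grid (Nat.lt_succ_self j)) k
    rwa [nsmul_eq_mul] at this
  · rintro ⟨n, hn⟩
    have h3 : (denom (j + 1) : ℝ) = 2 * denom j ^ 2 := by exact_mod_cast denom_succ j
    rw [expo, h3] at hn
    field_simp at hn
    have h4 : (2 * denom j * (i + k * denom j * (gapBound j + 1)) + k : ℤ) = 2 * denom j * n := by
      have : (2 * denom j * (i + k * denom j * (gapBound j + 1)) + k : ℝ) = 2 * denom j * n := by
        nlinarith
      exact_mod_cast this
    have h5 : (2 * denom j : ℤ) ∣ k :=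
      ⟨n - (i + k * denom j * (gapBound j + 1)), by linarith⟩
    have h6 := Int.le_of_dvd (by omega) h5
    omega

section Series

variable {K : Type*} [Field K]

/-- The `m`-th tail of the series `∑ t ^ (θ * expo i, a i)`. -/
noncomputable def wildTail (K : Type*) [Field K] {θ : ℝ} (hθ : 0 < θ) (a : ℕ → ℤ) (m : ℕ) :
    HahnSeries LexGroup K where
  coeff := Set.indicator ((fun i => lexPair (θ * expo i) (a i)) '' Set.Ici m) 1
  isPWO_support' := by
    refine Set.IsPWO.mono ?_ (Function.support_subset_iff'.2 fun γ hγ =>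
      Set.indicator_of_notMem hγ _)
    refine (Set.isPWO_of_wellQuasiOrderedLE _).image_of_monotone ?_
    refine monotone_nat_of_le_succ fun i => (lt_of_fst_lt ?_).le
    simp only [fst_lexPair]
    exact mul_lt_mul_of_pos_left (expo_strictMono (Nat.lt_succ_self i)) hθ

lemma lexPair_expo_injective {θ : ℝ} (hθ : 0 < θ) (a : ℕ → ℤ) :
    Function.Injective (fun i => lexPair (θ * expo i) (a i)) := by
  intro i j h
  have := congrArg (fun γ => (ofLex γ).1) h
  simp only [fst_lexPair] at this
  exact expo_strictMono.injective (mul_left_cancel₀ hθ.ne' this)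

lemma wildTail_eq {θ : ℝ} (hθ : 0 < θ) (a : ℕ → ℤ) (m : ℕ) :
    wildTail K hθ a m = mono K (θ * expo m) (a m) + wildTail K hθ a (m + 1) := by
  ext γ
  rw [HahnSeries.coeff_add]
  have hm : ∀ n, γ ∈ (fun i => lexPair (θ * expo i) (a i)) '' Set.Ici n ↔
      ∃ i, n ≤ i ∧ lexPair (θ * expo i) (a i) = γ := fun n => by
    simp only [Set.mem_image, Set.mem_Ici]
  simp only [wildTail, mono, HahnSeries.coeff_single]
  by_cases h : γ = lexPair (θ * expo m) (a m)
  · rw [if_pos h, Set.indicator_of_mem ((hm m).2 ⟨m, le_rfl, h.symm⟩), Set.indicator_of_notMem,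
      add_zero, Pi.one_apply]
    rw [hm]
    rintro ⟨i, hi, hi'⟩
    have := lexPair_expo_injective hθ a (hi'.trans h)
    omega
  · rw [if_neg h, zero_add]
    by_cases h' : γ ∈ (fun i => lexPair (θ * expo i) (a i)) '' Set.Ici m
    · obtain ⟨i, hi, hi'⟩ := (hm m).1 h'
      have him : i ≠ m := by rintro rfl; exact h hi'.symm
      rw [Set.indicator_of_mem h', Set.indicator_of_mem ((hm (m + 1)).2 ⟨i, by omega, hi'⟩)]
    · rw [Set.indicator_of_notMem h', Set.indicator_of_notMem]
      rw [hm] at h' ⊢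
      rintro ⟨i, hi, hi'⟩
      exact h' ⟨i, by omega, hi'⟩

lemma wildTail_zero_eq {θ : ℝ} (hθ : 0 < θ) (a : ℕ → ℤ) (m : ℕ) :
    wildTail K hθ a 0 =
      ∑ i ∈ Finset.range m, mono K (θ * expo i) (a i) + wildTail K hθ a m := by
  induction m with
  | zero => simp
  | succ m ih => rw [ih, Finset.sum_range_succ, add_assoc, ← wildTail_eq]

lemma exists_of_mem_support_wildTail {θ : ℝ} {hθ : 0 < θ} {a : ℕ → ℤ} {m : ℕ} {γ : LexGroup}
    (h : γ ∈ (wildTail K hθ a m).support) : ∃ i, m ≤ i ∧ γ = lexPair (θ * expo i) (a i) := by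
  have : γ ∈ (fun i => lexPair (θ * expo i) (a i)) '' Set.Ici m := by
    by_contra h'
    exact h (Set.indicator_of_notMem h' _)
  obtain ⟨i, hi, rfl⟩ := this
  exact ⟨i, hi, rfl⟩

lemma order_wildTail {θ : ℝ} (hθ : 0 < θ) (a : ℕ → ℤ) (m : ℕ) :
    wildTail K hθ a m ≠ 0 ∧ (wildTail K hθ a m).order = lexPair (θ * expo m) (a m) := by
  have hc : (wildTail K hθ a m).coeff (lexPair (θ * expo m) (a m)) ≠ 0 := by
    have hm : lexPair (θ * expo m) (a m) ∈
        (fun i => lexPair (θ * expo i) (a i)) '' Set.Ici m := ⟨m, Set.mem_Ici.2 le_rfl, rfl⟩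
    simp only [wildTail]
    rw [Set.indicator_of_mem hm]
    exact one_ne_zero
  have h0 : wildTail K hθ a m ≠ 0 := by
    intro h; rw [h] at hc; exact hc rfl
  refine ⟨h0, le_antisymm (HahnSeries.order_le_of_coeff_ne_zero hc) ?_⟩
  rw [HahnSeries.le_order_iff_forall h0]
  intro δ hδ
  by_contra hcon
  obtain ⟨i, hi, rfl⟩ := exists_of_mem_support_wildTail (HahnSeries.mem_support _ _ |>.2 hcon)
  have h1 := fst_le_of_le hδ.le
  simp only [fst_lexPair] at h1
  have h2 : i ≤ m := expo_strictMono.le_iff_le.1 (le_of_mul_le_mul_left h1 hθ)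
  have h3 : i = m := le_antisymm h2 hi
  subst h3
  exact lt_irrefl _ hδ

/-- The `j`-th key polynomial depends only on the first `j` coefficients `a i`. -/
lemma exists_key_of_prefix (K : Type*) [Field K] {θ : ℝ} (hθ : 0 < θ) (j : ℕ) (b : ℕ → ℤ) :
    ∃ (P : MvPolynomial (Fin 3) K) (k i : ℕ) (c : ℤ), 1 ≤ k ∧
      IsLevel j (i / denom j + k * expo j) ∧
      ∀ a : ℕ → ℤ, (∀ l < j, a l = b l) →
        MvPolynomial.aeval ![mono K θ 0, wildTail K hθ a 0, mono K 0 1] P ≠ 0 ∧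
        (MvPolynomial.aeval ![mono K θ 0, wildTail K hθ a 0, mono K 0 1] P).order =
          lexPair (θ * (i / denom j + k * expo j)) (c + k * a j) := by
  set p : HahnSeries LexGroup K := ∑ l ∈ Finset.range j, mono K (θ * expo l) (b l) with hp
  have hbox : p ∈ boxed K θ (denom j) (denom j * expBound j)
      (-((∑ l ∈ Finset.range j, (b l).natAbs : ℕ) : ℤ))
      (∑ l ∈ Finset.range j, (b l).natAbs : ℕ) := by
    refine Submodule.sum_mem _ fun l hl => ?_
    have hle : (b l).natAbs ≤ ∑ l ∈ Finset.range j, (b l).natAbs :=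
      Finset.single_le_sum (f := fun l => (b l).natAbs) (fun _ _ => Nat.zero_le _) hl
    obtain ⟨n, hn, hn'⟩ := expo_eq_div (Finset.mem_range.1 hl)
    exact mono_mem_boxed ⟨n, hn, by rw [hn']⟩ (by omega) (by omega)
  obtain ⟨P, k, i, c, hk, hk', hi, hP⟩ := exists_key_polynomial hθ (denom_pos j) p _ hbox
  have hgap : denom j * (denom j * (denom j * expBound j)) + denom j * (denom j * expBound j) =
      denom j * gapBound j := by unfold gapBound; ring
  rw [hgap] at hi hP
  refine ⟨P, k, i, c, hk, isLevel_of_eq hk hk' hi, fun a ha => ?_⟩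
  have hy : wildTail K hθ a 0 = p + wildTail K hθ a j := by
    rw [wildTail_zero_eq hθ a j, hp]
    congr 1
    exact Finset.sum_congr rfl fun l hl => by rw [ha l (Finset.mem_range.1 hl)]
  obtain ⟨h0, hord⟩ := order_wildTail (K := K) hθ a j
  have := hP (wildTail K hθ a j) h0 (by
    rw [hord, fst_lexPair]
    refine mul_lt_mul_of_pos_left ?_ hθ
    have := denom_cast_pos j
    push_cast
    rw [mul_div_cancel_left₀ _ this.ne']
    exact gapBound_lt_expo j)
  rw [hy]
  refine ⟨this.1, this.2.trans ?_⟩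
  rw [hord, lexPair_nsmul, lexPair_add]
  congr 1
  ring

lemma exists_seq_of_prefix (A : ℕ → (ℕ → ℤ) → ℤ) :
    ∃ a : ℕ → ℤ, ∀ j, a j = A j (fun i => if i < j then a i else 0) := by
  let a : ℕ → ℤ := WellFounded.fix (C := fun _ => ℤ) Nat.lt_wfRel.wf
    (fun j rec => A j (fun i => if h : i < j then rec i h else 0))
  refine ⟨a, fun j => ?_⟩
  have := WellFounded.fix_eq (C := fun _ => ℤ) Nat.lt_wfRel.wf
    (fun j rec => A j (fun i => if h : i < j then rec i h else 0)) j
  refine this.trans ?_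
  congr 1

/-- The coefficients can be chosen so that the key polynomials have prescribed very negative
second value coordinate. -/
lemma exists_negative_seq (K : Type*) [Field K] {θ : ℝ} (hθ : 0 < θ) (F : ℕ → ℤ) :
    ∃ a : ℕ → ℤ, ∀ j, ∃ (P : MvPolynomial (Fin 3) K) (r : ℝ) (c : ℤ), IsLevel j r ∧ c < F j ∧
      MvPolynomial.aeval ![mono K θ 0, wildTail K hθ a 0, mono K 0 1] P ≠ 0 ∧
      (MvPolynomial.aeval ![mono K θ 0, wildTail K hθ a 0, mono K 0 1] P).order =
        lexPair (θ * r) c := by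
  choose P k i c hk hlev hP using exists_key_of_prefix K hθ
  obtain ⟨a, ha⟩ := exists_seq_of_prefix (fun j b => -(|c j b| + |F j| + 1))
  refine ⟨a, fun j => ?_⟩
  set b : ℕ → ℤ := fun i => if i < j then a i else 0 with hb
  have h := hP j b a (fun l hl => by simp [hb, hl])
  refine ⟨P j b, _, _, hlev j b, ?_, h⟩
  have h1 : (1 : ℤ) ≤ k j b := by exact_mod_cast hk j b
  have h2 := ha j
  have h3 := le_abs_self (c j b)
  have h4 := neg_abs_le (F j)
  have h5 := abs_nonneg (c j b)
  have h6 := abs_nonneg (F j)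
  have h7 : (k j b : ℤ) * a j ≤ a j := by nlinarith
  linarith

end Series

/-- The subgroup of `LexGroup` of elements with first coordinate in `P + Q √2`. -/
def splitGroup (P Q : AddSubgroup ℝ) : AddSubgroup LexGroup where
  carrier := {γ | ∃ p ∈ P, ∃ q ∈ Q, (ofLex γ).1 = p + q * Real.sqrt 2}
  zero_mem' := ⟨0, P.zero_mem, 0, Q.zero_mem, by simp⟩
  add_mem' := by
    rintro a b ⟨p, hp, q, hq, h⟩ ⟨p', hp', q', hq', h'⟩
    exact ⟨p + p', P.add_mem hp hp', q + q', Q.add_mem hq hq', by rw [fst_add, h, h']; ring⟩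
  neg_mem' := by
    rintro a ⟨p, hp, q, hq, h⟩
    exact ⟨-p, P.neg_mem hp, -q, Q.neg_mem hq, by rw [fst_neg, h]; ring⟩

/-- The monoid containing all values of nonzero polynomials in the embedding below. -/
def valueMonoid (e : ℕ → ℤ) : AddSubmonoid LexGroup where
  carrier := {γ | ∃ p ∈ dyadic, ∃ q ∈ dyadic, 0 ≤ p ∧ 0 ≤ q ∧
    (ofLex γ).1 = p + q * Real.sqrt 2 ∧
    (p = 0 → 0 ≤ (ofLex γ).2 ∧ ∀ j, q ∈ grid (denom j) ∨ e j ≤ (ofLex γ).2)}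
  zero_mem' := ⟨0, dyadic.zero_mem, 0, dyadic.zero_mem, le_rfl, le_rfl, by simp, fun _ =>
    ⟨le_rfl, fun j => Or.inl (zero_mem _)⟩⟩
  add_mem' := by
    rintro a b ⟨p, hp, q, hq, hp0, hq0, h, h1⟩ ⟨p', hp', q', hq', hp0', hq0', h', h1'⟩
    refine ⟨p + p', add_mem hp hp', q + q', add_mem hq hq', by positivity, by positivity,
      by rw [fst_add, h, h']; ring, fun h0 => ?_⟩
    obtain ⟨h2, h3⟩ := h1 (by linarith)
    obtain ⟨h2', h3'⟩ := h1' (by linarith)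
    rw [snd_add]
    refine ⟨by positivity, fun j => ?_⟩
    rcases h3 j with h4 | h4
    · rcases h3' j with h5 | h5
      · exact Or.inl (add_mem h4 h5)
      · exact Or.inr (by linarith)
    · exact Or.inr (by linarith)

lemma mem_valueMonoid {e : ℕ → ℤ} {γ : LexGroup} : γ ∈ valueMonoid e ↔
    ∃ p ∈ dyadic, ∃ q ∈ dyadic, 0 ≤ p ∧ 0 ≤ q ∧ (ofLex γ).1 = p + q * Real.sqrt 2 ∧
    (p = 0 → 0 ≤ (ofLex γ).2 ∧ ∀ j, q ∈ grid (denom j) ∨ e j ≤ (ofLex γ).2) := Iff.rfl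

lemma nonneg_of_mem_valueMonoid {e : ℕ → ℤ} {γ : LexGroup} (h : γ ∈ valueMonoid e) : 0 ≤ γ := by
  obtain ⟨p, hp, q, hq, hp0, hq0, h, h1⟩ := h
  rw [lex_le_iff, h, fst_zero, snd_zero]
  have h2 : 0 ≤ q * Real.sqrt 2 := by positivity
  rcases hp0.eq_or_lt with h0 | h0
  · rcases h2.eq_or_lt with h3 | h3
    · exact Or.inr ⟨by rw [← h0, ← h3]; simp, (h1 h0.symm).1⟩
    · exact Or.inl (by linarith)
  · exact Or.inl (by linarith)

lemma le_snd_of_mem_valueMonoid {e : ℕ → ℤ} {γ : LexGroup} (h : γ ∈ valueMonoid e) {r : ℝ}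
    (hr : r ∈ dyadic) (hγ : (ofLex γ).1 = r * Real.sqrt 2) {j : ℕ} (hj : r ∉ grid (denom j)) :
    e j ≤ (ofLex γ).2 := by
  obtain ⟨p, hp, q, hq, hp0, hq0, h, h1⟩ := h
  obtain ⟨rfl, rfl⟩ := dyadic_add_mul_sqrt_two_inj hp hq dyadic.zero_mem hr
    (by rw [← h, hγ, zero_add])
  exact ((h1 rfl).2 j).resolve_left hj

section Embedding

variable {K : Type*} [Field K]

lemma mono_mem_supportSubalgebra {T : AddSubmonoid LexGroup} {r : ℝ} {k : ℤ}
    (h : lexPair r k ∈ T) : mono K r k ∈ supportSubalgebra K T := by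
  intro γ hγ
  have : γ = lexPair r k := HahnSeries.eq_of_mem_support_single hγ
  rwa [this]

lemma wildTail_mem_supportSubalgebra {T : AddSubmonoid LexGroup} {θ : ℝ} {hθ : 0 < θ}
    {a : ℕ → ℤ} (h : ∀ i, lexPair (θ * expo i) (a i) ∈ T) (m : ℕ) :
    wildTail K hθ a m ∈ supportSubalgebra K T := by
  intro γ hγ
  obtain ⟨i, -, rfl⟩ := exists_of_mem_support_wildTail hγ
  exact h i

/-- There are key polynomials of every level for the series `t`. -/
def HasKeys (θ : ℝ) (t : HahnSeries LexGroup K) : Prop :=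
  ∀ j, ∃ (P : MvPolynomial (Fin 3) K) (r : ℝ) (c : ℤ), IsLevel j r ∧
    MvPolynomial.aeval ![mono K θ 0, t, mono K 0 1] P ≠ 0 ∧
    (MvPolynomial.aeval ![mono K θ 0, t, mono K 0 1] P).order = lexPair (θ * r) c

lemma hasKeys_wildTail {θ : ℝ} (hθ : 0 < θ) (a : ℕ → ℤ) : HasKeys θ (wildTail K hθ a 0) := by
  intro j
  obtain ⟨P, k, i, c, -, hlev, h⟩ := exists_key_of_prefix K hθ j a
  exact ⟨P, _, _, hlev, h a fun _ _ => rfl⟩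

lemma algebraicIndepOn_insert_of_order {ι : Type*} {w : ι → HahnSeries LexGroup K} {s : Set ι}
    (hs : AlgebraicIndepOn K w s) {i : ι} {Λ : AddSubgroup LexGroup}
    (hw : ∀ k ∈ s, w k ∈ supportSubalgebra K Λ.toAddSubmonoid) (Q : ℕ → HahnSeries LexGroup K)
    (hQ : ∀ j, Q j ∈ Algebra.adjoin K (insert (w i) (w '' s))) (hQ0 : ∀ j, Q j ≠ 0)
    (hne : ∀ i j, i < j → (Q j).order - (Q i).order ∉ Λ) :
    AlgebraicIndepOn K w (insert i s) := by
  refine hs.insert (transcendental_of_order _ Λ (fun a ha ha0 => ?_) _ Q hQ hQ0 hne)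
  have hle : Algebra.adjoin K (w '' s) ≤ supportSubalgebra K Λ.toAddSubmonoid := by
    rw [Algebra.adjoin_le_iff]
    rintro _ ⟨k, hk, rfl⟩
    exact hw k hk
  exact order_mem_of_mem_supportSubalgebra (hle ha) ha0

lemma aeval_mem_adjoin {ι : Type*} (t : ι → HahnSeries LexGroup K)
    {S : Set (HahnSeries LexGroup K)} (h : ∀ i, t i ∈ S) (P : MvPolynomial ι K) :
    MvPolynomial.aeval t P ∈ Algebra.adjoin K S := by
  have : MvPolynomial.aeval t P ∈ Algebra.adjoin K (Set.range t) := by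
    rw [Algebra.adjoin_range_eq_range_aeval]
    exact ⟨P, rfl⟩
  exact Algebra.adjoin_mono (by rintro _ ⟨i, rfl⟩; exact h i) this

lemma algebraicIndepOn_insert_of_hasKeys {ι : Type*} {w : ι → HahnSeries LexGroup K} {s : Set ι}
    (hs : AlgebraicIndepOn K w s) {i : ι} {θ : ℝ} (hi : HasKeys θ (w i))
    (hθ : mono K θ 0 ∈ w '' s) (hz : mono K 0 1 ∈ w '' s) {Λ : AddSubgroup LexGroup}
    (hw : ∀ k ∈ s, w k ∈ supportSubalgebra K Λ.toAddSubmonoid)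
    (hΛ : ∀ (r : ℝ) (c : ℤ), r ∈ dyadic → lexPair (θ * r) c ∈ Λ → r ∈ grid 1) :
    AlgebraicIndepOn K w (insert i s) := by
  choose P r c hlev hP0 hP using hi
  refine algebraicIndepOn_insert_of_order hs hw
    (fun j => MvPolynomial.aeval ![mono K θ 0, w i, mono K 0 1] (P j)) (fun j => ?_) hP0 ?_
  · refine aeval_mem_adjoin _ (fun k => ?_) _
    fin_cases k
    · exact Or.inr hθ
    · exact Or.inl rfl
    · exact Or.inr hz
  · intro k j hkj h
    have hk : r k ∈ grid (denom j) := grid_denom_mono (Nat.succ_le_of_lt hkj) (hlev k).mem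
    have e : lexPair (θ * r j) (c j) - lexPair (θ * r k) (c k) =
        lexPair (θ * (r j - r k)) (c j - c k) :=
      lex_ext (by simp [mul_sub]) (by simp)
    rw [hP, hP, e] at h
    have h1 := hΛ _ _ (sub_mem (grid_denom_le_dyadic _ (hlev j).mem)
      (grid_denom_le_dyadic _ (hlev k).mem)) h
    have h2 : r j - r k ∈ grid (denom j) := grid_denom_mono (Nat.zero_le j) h1
    apply (hlev j).notMem
    have := add_mem h2 hk
    rwa [sub_add_cancel] at this

lemma sqrt_two_pos : 0 < Real.sqrt 2 := by positivity

/-- The images of the five variables in the field of Hahn series. -/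
noncomputable def gens (K : Type*) [Field K] (a e : ℕ → ℤ) : Fin 5 → HahnSeries LexGroup K :=
  ![mono K 1 0, wildTail K one_pos a 0, mono K (Real.sqrt 2) 0, wildTail K sqrt_two_pos e 0,
    mono K 0 1]

lemma expo_mem_dyadic (i : ℕ) : expo i ∈ dyadic :=
  grid_denom_le_dyadic _ (expo_mem_grid (Nat.lt_succ_self i))

lemma one_mem_grid_one : (1 : ℝ) ∈ grid 1 := ⟨1, by simp⟩

lemma grid_one_le_dyadic : grid 1 ≤ dyadic := grid_denom_le_dyadic 0

lemma gens_mem_supportSubalgebra (a : ℕ → ℤ) {e : ℕ → ℤ} (he : Monotone e) (he0 : ∀ j, 0 ≤ e j)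
    (i : Fin 5) : gens K a e i ∈ supportSubalgebra K (valueMonoid e) := by
  have h1 : (1 : ℝ) ∈ dyadic := grid_one_le_dyadic one_mem_grid_one
  fin_cases i
  · exact mono_mem_supportSubalgebra ⟨1, h1, 0, dyadic.zero_mem, by simp, le_rfl, by simp,
      fun h => by norm_num at h⟩
  · refine wildTail_mem_supportSubalgebra (hθ := one_pos) (fun i => ?_) 0
    exact ⟨expo i, expo_mem_dyadic i, 0, dyadic.zero_mem, (expo_pos i).le, le_rfl, by simp,
      fun h => ((expo_pos i).ne' h).elim⟩
  · exact mono_mem_supportSubalgebra ⟨0, dyadic.zero_mem, 1, h1, le_rfl, by simp, by simp,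
      fun _ => ⟨by simp, fun j => Or.inl (grid_denom_mono (Nat.zero_le j) one_mem_grid_one)⟩⟩
  · refine wildTail_mem_supportSubalgebra (hθ := sqrt_two_pos) (fun i => ?_) 0
    refine ⟨0, dyadic.zero_mem, expo i, expo_mem_dyadic i, le_rfl, (expo_pos i).le,
      by simp [mul_comm], fun _ => ⟨he0 i, fun j => ?_⟩⟩
    rcases lt_or_ge i j with h | h
    · exact Or.inl (expo_mem_grid h)
    · exact Or.inr (he h)
  · exact mono_mem_supportSubalgebra ⟨0, dyadic.zero_mem, 0, dyadic.zero_mem, le_rfl, le_rfl,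
      by simp, fun _ => ⟨by simp, fun j => Or.inl (zero_mem _)⟩⟩

lemma aeval_gens_mem (a : ℕ → ℤ) {e : ℕ → ℤ} (he : Monotone e) (he0 : ∀ j, 0 ≤ e j)
    (p : MvPolynomial (Fin 5) K) :
    MvPolynomial.aeval (gens K a e) p ∈ supportSubalgebra K (valueMonoid e) := by
  have h := aeval_mem_adjoin (S := Set.range (gens K a e)) (gens K a e) (fun i => ⟨i, rfl⟩) p
  refine Algebra.adjoin_le ?_ h
  rintro _ ⟨i, rfl⟩
  exact gens_mem_supportSubalgebra a he he0 i

lemma algebraicIndependent_gens (a e : ℕ → ℤ) : AlgebraicIndependent K (gens K a e) := by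
  have h1 : (1 : ℝ) ∈ grid 1 := one_mem_grid_one
  have hempty : AlgebraicIndepOn K (gens K a e) ∅ :=
    algebraicIndependent_empty_type_iff.2 (algebraMap K (HahnSeries LexGroup K)).injective
  have hpow : ∀ (i : Fin 5) (s : Set (Fin 5)) (j : ℕ), gens K a e i ^ j ∈
      Algebra.adjoin K (insert (gens K a e i) (gens K a e '' s)) := fun i s j =>
    Subalgebra.pow_mem _ (Algebra.subset_adjoin (Set.mem_insert _ _)) _
  have hz : AlgebraicIndepOn K (gens K a e) {4} := by
    have := algebraicIndepOn_insert_of_order hempty (i := 4) (Λ := ⊥) (by simp)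
      (fun j => gens K a e 4 ^ j) (hpow 4 _) (fun j => pow_ne_zero _ (mono_ne_zero _ _)) ?_
    · simpa using this
    · intro i j hij h
      have h2 := congrArg (fun γ => (ofLex γ).2) (AddSubgroup.mem_bot.1 h)
      simp only [HahnSeries.order_pow, snd_sub, snd_nsmul] at h2
      have h3 : (gens K a e 4).order = lexPair 0 1 := order_mono _ _
      rw [h3, snd_lexPair, snd_zero] at h2
      omega
  have hx : AlgebraicIndepOn K (gens K a e) {0, 4} := by
    refine algebraicIndepOn_insert_of_order hz (i := 0) (Λ := splitGroup ⊥ ⊥) ?_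
      (fun j => gens K a e 0 ^ j) (hpow 0 _) (fun j => pow_ne_zero _ (mono_ne_zero _ _)) ?_
    · rintro k rfl
      exact mono_mem_supportSubalgebra ⟨0, zero_mem _, 0, zero_mem _, by simp⟩
    · rintro i j hij ⟨p, hp, q, hq, h⟩
      rw [AddSubgroup.mem_bot] at hp hq
      subst hp hq
      have h3 : (gens K a e 0).order = lexPair 1 0 := order_mono _ _
      simp only [HahnSeries.order_pow, fst_sub, fst_nsmul, h3, fst_lexPair] at h
      have : (i : ℝ) < j := by exact_mod_cast hij
      linarith
  have hu : AlgebraicIndepOn K (gens K a e) {2, 0, 4} := by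
    refine algebraicIndepOn_insert_of_order hx (i := 2) (Λ := splitGroup (grid 1) ⊥) ?_
      (fun j => gens K a e 2 ^ j) (hpow 2 _) (fun j => pow_ne_zero _ (mono_ne_zero _ _)) ?_
    · rintro k (rfl | rfl)
      · exact mono_mem_supportSubalgebra ⟨1, h1, 0, zero_mem _, by simp⟩
      · exact mono_mem_supportSubalgebra ⟨0, zero_mem _, 0, zero_mem _, by simp⟩
    · rintro i j hij ⟨p, hp, q, hq, h⟩
      rw [AddSubgroup.mem_bot] at hq
      subst hq
      have h3 : (gens K a e 2).order = lexPair (Real.sqrt 2) 0 := order_mono _ _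
      simp only [HahnSeries.order_pow, fst_sub, fst_nsmul, h3, fst_lexPair] at h
      have h4 : ∀ n : ℕ, (n : ℝ) ∈ dyadic := fun n => grid_one_le_dyadic ⟨n, by simp⟩
      have h5 := (eq_zero_of_dyadic_add_mul_sqrt_two (neg_mem (grid_one_le_dyadic hp))
        (sub_mem (h4 j) (h4 i)) (by linarith)).2
      have : (i : ℝ) < j := by exact_mod_cast hij
      linarith
  have hy : AlgebraicIndepOn K (gens K a e) {1, 2, 0, 4} := by
    refine algebraicIndepOn_insert_of_hasKeys hu (i := 1) (θ := 1)
      (Λ := splitGroup (grid 1) (grid 1)) (hasKeys_wildTail one_pos _)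
      ⟨0, by simp, rfl⟩ ⟨4, by simp, rfl⟩ ?_ ?_
    · rintro k (rfl | rfl | rfl)
      · exact mono_mem_supportSubalgebra ⟨0, zero_mem _, 1, h1, by simp⟩
      · exact mono_mem_supportSubalgebra ⟨1, h1, 0, zero_mem _, by simp⟩
      · exact mono_mem_supportSubalgebra ⟨0, zero_mem _, 0, zero_mem _, by simp⟩
    · rintro r c hr ⟨p, hp, q, hq, h⟩
      rw [fst_lexPair, one_mul] at h
      have := (dyadic_add_mul_sqrt_two_inj hr dyadic.zero_mem (grid_one_le_dyadic hp)
        (grid_one_le_dyadic hq) (by rw [← h]; ring)).1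
      rwa [this]
  have hv : AlgebraicIndepOn K (gens K a e) {3, 1, 2, 0, 4} := by
    refine algebraicIndepOn_insert_of_hasKeys hy (i := 3) (θ := Real.sqrt 2)
      (Λ := splitGroup dyadic (grid 1)) (hasKeys_wildTail sqrt_two_pos _)
      ⟨2, by simp, rfl⟩ ⟨4, by simp, rfl⟩ ?_ ?_
    · rintro k (rfl | rfl | rfl | rfl)
      · refine wildTail_mem_supportSubalgebra (hθ := one_pos) (fun i => ?_) 0
        exact ⟨expo i, expo_mem_dyadic i, 0, zero_mem _, by simp⟩
      · exact mono_mem_supportSubalgebra ⟨0, zero_mem _, 1, h1, by simp⟩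
      · exact mono_mem_supportSubalgebra ⟨1, grid_one_le_dyadic h1, 0, zero_mem _, by simp⟩
      · exact mono_mem_supportSubalgebra ⟨0, zero_mem _, 0, zero_mem _, by simp⟩
    · rintro r c hr ⟨p, hp, q, hq, h⟩
      rw [fst_lexPair] at h
      have := (dyadic_add_mul_sqrt_two_inj dyadic.zero_mem hr hp
        (grid_one_le_dyadic hq) (by rw [← h]; ring)).2
      rwa [this]
  rw [← AlgebraicIndepOn.univ]
  refine hv.mono fun i _ => ?_
  fin_cases i <;> simp

end Embedding

section Comparison

variable {F : Type*} [Field F]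

/-- Additive valuations with values in `LexGroup` and value group `H × ℤ`. -/
structure IsVal (ν : F → LexGroup) : Prop where
  mul : ∀ x y, x ≠ 0 → y ≠ 0 → ν (x * y) = ν x + ν y
  add : ∀ x y, x ≠ 0 → y ≠ 0 → x + y ≠ 0 → min (ν x) (ν y) ≤ ν (x + y)
  range : ∀ γ : LexGroup, (∃ x, x ≠ 0 ∧ ν x = γ) ↔ (ofLex γ).1 ∈ dyadicSqrt2Set

namespace IsVal

variable {ν ω : F → LexGroup}

lemma one (hν : IsVal ν) : ν 1 = 0 := by
  have := hν.mul 1 1 one_ne_zero one_ne_zero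
  rw [one_mul] at this
  exact (add_eq_left.1 this.symm)

lemma inv (hν : IsVal ν) {x : F} (hx : x ≠ 0) : ν x⁻¹ = -ν x := by
  have := hν.mul x⁻¹ x (inv_ne_zero hx) hx
  rw [inv_mul_cancel₀ hx, hν.one] at this
  exact eq_neg_of_add_eq_zero_left this.symm

lemma div (hν : IsVal ν) {x y : F} (hx : x ≠ 0) (hy : y ≠ 0) : ν (x / y) = ν x - ν y := by
  rw [div_eq_mul_inv, hν.mul _ _ hx (inv_ne_zero hy), hν.inv hy, sub_eq_add_neg]

lemma pow (hν : IsVal ν) {x : F} (hx : x ≠ 0) (n : ℕ) : ν (x ^ n) = n • ν x := by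
  induction n with
  | zero => simp [hν.one]
  | succ n ih => rw [pow_succ, hν.mul _ _ (pow_ne_zero _ hx) hx, ih, succ_nsmul]

lemma le_iff (hν : IsVal ν) (hω : IsVal ω) (h : ∀ x, x ≠ 0 → (0 ≤ ν x ↔ 0 ≤ ω x)) {x y : F}
    (hx : x ≠ 0) (hy : y ≠ 0) : ν x ≤ ν y ↔ ω x ≤ ω y := by
  have := h (y / x) (div_ne_zero hy hx)
  rwa [hν.div hy hx, hω.div hy hx, sub_nonneg, sub_nonneg] at this

lemma eq_iff (hν : IsVal ν) (hω : IsVal ω) (h : ∀ x, x ≠ 0 → (0 ≤ ν x ↔ 0 ≤ ω x)) {x y : F}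
    (hx : x ≠ 0) (hy : y ≠ 0) : ν x = ν y ↔ ω x = ω y := by
  rw [le_antisymm_iff, le_antisymm_iff, le_iff hν hω h hx hy, le_iff hν hω h hy hx]

lemma zero_mem_dyadicSqrt2Set : (0 : ℝ) ∈ dyadicSqrt2Set :=
  ⟨0, 0, 0, 0, by simp⟩

lemma lexPair_zero_one_le {γ : LexGroup} (h : 0 < γ) : lexPair 0 1 ≤ γ := by
  rw [lex_lt_iff] at h
  rw [lex_le_iff]
  exact h.imp id fun h => ⟨h.1, Int.add_one_le_of_lt h.2⟩

lemma eq_of_zero_one (hν : IsVal ν) (hω : IsVal ω) (h : ∀ x, x ≠ 0 → (0 ≤ ν x ↔ 0 ≤ ω x)) {z : F}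
    (hz : z ≠ 0) (hνz : ν z = lexPair 0 1) : ω z = lexPair 0 1 := by
  obtain ⟨z', hz', hωz'⟩ := (hω.range (lexPair 0 1)).2 zero_mem_dyadicSqrt2Set
  have hpos : (0 : LexGroup) < lexPair 0 1 := (lex_lt_iff _ _).2 (Or.inr (by simp))
  have hlt : ∀ x, x ≠ 0 → (0 < ν x ↔ 0 < ω x) := fun x hx => by
    have := le_iff hν hω h hx one_ne_zero
    rw [hν.one, hω.one] at this
    rw [← not_le, ← not_le, this]
  have h1 : 0 < ω z := (hlt z hz).1 (hνz ▸ hpos)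
  have h2 : 0 < ν z' := (hlt z' hz').2 (hωz' ▸ hpos)
  refine le_antisymm ?_ (lexPair_zero_one_le h1)
  rw [← hωz', ← le_iff hν hω h hz hz', hνz]
  exact lexPair_zero_one_le h2

lemma eq_of_fst_eq_zero (hν : IsVal ν) (hω : IsVal ω)
    (h : ∀ x, x ≠ 0 → (0 ≤ ν x ↔ 0 ≤ ω x)) {x : F} (hx : x ≠ 0) (h0 : (ofLex (ν x)).1 = 0) :
    ω x = ν x := by
  obtain ⟨z, hz, hνz⟩ := (hν.range (lexPair 0 1)).2 zero_mem_dyadicSqrt2Set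
  have hωz := eq_of_zero_one hν hω h hz hνz
  have key : ∀ (y : F) (n : ℕ), y ≠ 0 → ν y = lexPair 0 n → ω y = lexPair 0 n := by
    intro y n hy hyn
    have e : n • lexPair 0 1 = lexPair 0 n := by rw [lexPair_nsmul]; simp
    have h1 : ν y = ν (z ^ n) := by rw [hν.pow hz, hyn, hνz, e]
    rw [(eq_iff hν hω h hy (pow_ne_zero _ hz)).1 h1, hω.pow hz, hωz, e]
  rcases le_total 0 (ofLex (ν x)).2 with h1 | h1
  · obtain ⟨n, hn⟩ := Int.eq_ofNat_of_zero_le h1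
    have e : ν x = lexPair 0 n := lex_ext h0 hn
    rw [key x n hx e, e]
  · obtain ⟨n, hn⟩ := Int.eq_ofNat_of_zero_le (neg_nonneg.2 h1)
    have e : ν x⁻¹ = lexPair 0 n := by
      rw [hν.inv hx]
      exact lex_ext (by simp [h0]) (by simpa using hn)
    have e2 := key x⁻¹ n (inv_ne_zero hx) e
    rw [← e, hω.inv hx, hν.inv hx] at e2
    exact neg_injective e2

lemma fst_eq_of_fst_eq (hν : IsVal ν) (hω : IsVal ω)
    (h : ∀ x, x ≠ 0 → (0 ≤ ν x ↔ 0 ≤ ω x)) {x y : F} (hx : x ≠ 0) (hy : y ≠ 0)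
    (hxy : (ofLex (ν x)).1 = (ofLex (ν y)).1) : (ofLex (ω x)).1 = (ofLex (ω y)).1 := by
  have h0 : (ofLex (ν (x / y))).1 = 0 := by rw [hν.div hx hy, fst_sub, hxy, sub_self]
  have h1 := eq_of_fst_eq_zero hν hω h (div_ne_zero hx hy) h0
  have h2 := congrArg (fun γ => (ofLex γ).1) h1
  simp only [h0] at h2
  rw [hω.div hx hy, fst_sub] at h2
  exact sub_eq_zero.1 h2

lemma snd_eq (hν : IsVal ν) (hω : IsVal ω) (h : ∀ x, x ≠ 0 → (0 ≤ ν x ↔ 0 ≤ ω x)) {x : F}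
    (hx : x ≠ 0) : (ofLex (ω x)).2 = (ofLex (ν x)).2 := by
  have hdiv : ∀ n : ℕ, (2 : ℤ) ^ n ∣ (ofLex (ω x)).2 - (ofLex (ν x)).2 := by
    intro n
    have hmem := (hν.range (ν x)).1 ⟨x, hx, rfl⟩
    have hmem' : (ofLex (ν x)).1 / 2 ^ n ∈ dyadicSqrt2Set := by
      obtain ⟨a, b, k, l, e⟩ := hmem
      refine ⟨a, b, k + n, l + n, ?_⟩
      rw [e, pow_add, pow_add]
      field_simp
    obtain ⟨t, ht, hνt⟩ := (hν.range (lexPair ((ofLex (ν x)).1 / 2 ^ n) 0)).2 hmem'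
    have hp : t ^ 2 ^ n ≠ 0 := pow_ne_zero _ ht
    have e : ν (x / t ^ 2 ^ n) = lexPair 0 (ofLex (ν x)).2 := by
      rw [hν.div hx hp, hν.pow ht, hνt, lexPair_nsmul]
      refine lex_ext ?_ ?_
      · simp only [fst_sub, fst_lexPair]
        push_cast
        field_simp
        simp
      · simp
    have e2 := eq_of_fst_eq_zero hν hω h (div_ne_zero hx hp) (by rw [e, fst_lexPair])
    rw [e, hω.div hx hp, hω.pow ht] at e2
    have e3 := congrArg (fun γ => (ofLex γ).2) e2
    simp only [snd_sub, snd_nsmul, snd_lexPair] at e3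
    push_cast at e3
    exact ⟨(ofLex (ω t)).2, by linarith⟩
  have h1 := hdiv ((ofLex (ω x)).2 - (ofLex (ν x)).2).natAbs
  have h2 : (ofLex (ω x)).2 - (ofLex (ν x)).2 = 0 := by
    by_contra hne
    have h3 := Int.natAbs_dvd_natAbs.2 h1
    rw [Int.natAbs_pow] at h3
    have h4 := Nat.le_of_dvd (Int.natAbs_pos.2 hne) h3
    exact absurd h4 (not_le.2 (Nat.lt_two_pow_self))
  linarith

lemma fst_le_of_lt (hν : IsVal ν) (hω : IsVal ω) (h : ∀ x, x ≠ 0 → (0 ≤ ν x ↔ 0 ≤ ω x))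
    {x t : F} (hx : x ≠ 0) (ht : t ≠ 0) {m : ℕ}
    (hlt : (ofLex (ν x)).1 < m * (ofLex (ν t)).1) :
    (ofLex (ω x)).1 ≤ m * (ofLex (ω t)).1 := by
  have h1 : ν x ≤ ν (t ^ m) := by
    rw [hν.pow ht]
    exact (lt_of_fst_lt (by rwa [fst_nsmul])).le
  rw [le_iff hν hω h hx (pow_ne_zero _ ht), hω.pow ht] at h1
  have := fst_le_of_le h1
  rwa [fst_nsmul] at this

/-- The values of a valuation on a noetherian subring on which it is nonnegative are well
ordered. -/
lemma exists_isLeast (hω : IsVal ω) {A : Type*} [CommRing A] [IsDomain A] [IsNoetherianRing A]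
    [Algebra A F] [FaithfulSMul A F] (hA : ∀ p : A, p ≠ 0 → 0 ≤ ω (algebraMap A F p))
    (S : Set LexGroup) (hS : S.Nonempty)
    (hSA : ∀ γ ∈ S, ∃ p : A, p ≠ 0 ∧ ω (algebraMap A F p) = γ) : ∃ γ, IsLeast S γ := by
  have hne : ∀ p : A, p ≠ 0 → algebraMap A F p ≠ 0 := fun p hp =>
    (map_ne_zero_iff _ (FaithfulSMul.algebraMap_injective A F)).2 hp
  let J : LexGroup → Ideal A := fun γ =>
    { carrier := {p | p ≠ 0 → γ ≤ ω (algebraMap A F p)}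
      zero_mem' := fun h => (h rfl).elim
      add_mem' := by
        intro p q hp hq hpq
        by_cases hp0 : p = 0
        · subst hp0; simpa using hq (by simpa using hpq)
        by_cases hq0 : q = 0
        · subst hq0; simpa using hp hp0
        rw [map_add]
        refine (le_min (hp hp0) (hq hq0)).trans (hω.add _ _ (hne p hp0) (hne q hq0) ?_)
        rw [← map_add]; exact hne _ hpq
      smul_mem' := by
        intro c p hp hcp
        have hc0 : c ≠ 0 := left_ne_zero_of_mul hcp
        have hp0 : p ≠ 0 := right_ne_zero_of_mul hcp
        rw [smul_eq_mul, map_mul, hω.mul _ _ (hne c hc0) (hne p hp0)]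
        exact (hp hp0).trans (le_add_of_nonneg_left (hA c hc0)) }
  obtain ⟨I, ⟨γ, hγ, rfl⟩, hmax⟩ := set_has_maximal_iff_noetherian.2 (inferInstance :
    IsNoetherian A A) (J '' S) (hS.image J)
  refine ⟨γ, hγ, fun δ hδ => ?_⟩
  by_contra hlt
  rw [not_le] at hlt
  refine hmax (J δ) ⟨δ, hδ, rfl⟩ (lt_of_le_of_ne (fun p hp hp0 => hlt.le.trans (hp hp0)) ?_)
  intro heq
  obtain ⟨p, hp0, hp⟩ := hSA δ hδ
  have h1 : p ∈ J δ := fun _ => hp.ge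
  rw [← heq] at h1
  exact absurd (h1 hp0) (not_le.2 (hp ▸ hlt))

end IsVal

end Comparison

section Polynomial

variable {K : Type*} [Field K]

lemma X_mem_mxyuvz (i : Fin 5) : (X i : MvPolynomial (Fin 5) K) ∈ mxyuvz K := by
  refine Ideal.subset_span ?_
  fin_cases i <;> simp

lemma sub_C_constantCoeff_mem (p : MvPolynomial (Fin 5) K) :
    p - C (constantCoeff p) ∈ mxyuvz K := by
  induction p using MvPolynomial.induction_on with
  | C a => simp
  | add p q hp hq =>
    rw [map_add, map_add, add_sub_add_comm]
    exact add_mem hp hq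
  | mul_X p i _ =>
    simpa using Ideal.mul_mem_left _ p (X_mem_mxyuvz i)

lemma order_C {c : K} (hc : c ≠ 0) {t : Fin 5 → HahnSeries LexGroup K} :
    aeval t (C c : MvPolynomial (Fin 5) K) ≠ 0 ∧
    (aeval t (C c : MvPolynomial (Fin 5) K)).order = 0 := by
  rw [← algebraMap_eq, AlgHom.commutes, HahnSeries.algebraMap_apply]
  exact ⟨HahnSeries.single_ne_zero hc, HahnSeries.order_single hc⟩

lemma aeval_gens_injective (K : Type*) [Field K] (a e : ℕ → ℤ) : Function.Injective
    (aeval (gens K a e) : MvPolynomial (Fin 5) K →ₐ[K] HahnSeries LexGroup K).toRingHom :=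
  algebraicIndependent_gens a e

/-- The embedding of the rational function field in the field of Hahn series. -/
noncomputable def embedding (K : Type*) [Field K] (a e : ℕ → ℤ) :
    FractionRing (MvPolynomial (Fin 5) K) →+* HahnSeries LexGroup K :=
  IsFractionRing.lift (aeval_gens_injective K a e)

lemma embedding_algebraMap (a e : ℕ → ℤ) (p : MvPolynomial (Fin 5) K) :
    embedding K a e (algebraMap _ _ p) = aeval (gens K a e) p :=
  IsFractionRing.lift_algebraMap (aeval_gens_injective K a e) p

/-- The valuation of the rational function field induced by the embedding. -/
noncomputable def wildVal (K : Type*) [Field K] (a e : ℕ → ℤ)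
    (x : FractionRing (MvPolynomial (Fin 5) K)) : LexGroup := (embedding K a e x).order

variable {a e : ℕ → ℤ}

lemma wildVal_algebraMap (p : MvPolynomial (Fin 5) K) :
    wildVal K a e (algebraMap _ _ p) = (aeval (gens K a e) p).order := by
  rw [wildVal, embedding_algebraMap]

lemma algebraMap_ne_zero {p : MvPolynomial (Fin 5) K} (hp : p ≠ 0) :
    algebraMap _ (FractionRing (MvPolynomial (Fin 5) K)) p ≠ 0 :=
  (map_ne_zero_iff _ (IsFractionRing.injective _ _)).2 hp

lemma aeval_gens_ne_zero {p : MvPolynomial (Fin 5) K} (hp : p ≠ 0) :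
    aeval (gens K a e) p ≠ 0 :=
  (map_ne_zero_iff _ (algebraicIndependent_gens a e)).2 hp

lemma wildVal_mul (x y : FractionRing (MvPolynomial (Fin 5) K)) (hx : x ≠ 0) (hy : y ≠ 0) :
    wildVal K a e (x * y) = wildVal K a e x + wildVal K a e y := by
  rw [wildVal, map_mul]
  exact HahnSeries.order_mul ((map_ne_zero _).2 hx) ((map_ne_zero _).2 hy)

lemma wildVal_add (x y : FractionRing (MvPolynomial (Fin 5) K)) (hxy : x + y ≠ 0) :
    min (wildVal K a e x) (wildVal K a e y) ≤ wildVal K a e (x + y) := by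
  have h : embedding K a e x + embedding K a e y ≠ 0 := by
    rw [← map_add]; exact (map_ne_zero _).2 hxy
  have := HahnSeries.min_order_le_order_add h
  rwa [← map_add] at this

lemma wildVal_mem (he : Monotone e) (he0 : ∀ j, 0 ≤ e j) {p : MvPolynomial (Fin 5) K}
    (hp : p ≠ 0) : wildVal K a e (algebraMap _ _ p) ∈ valueMonoid e := by
  rw [wildVal_algebraMap]
  exact order_mem_of_mem_supportSubalgebra (aeval_gens_mem a he he0 p) (aeval_gens_ne_zero hp)

lemma wildVal_nonneg (he : Monotone e) (he0 : ∀ j, 0 ≤ e j) {p : MvPolynomial (Fin 5) K}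
    (hp : p ≠ 0) : 0 ≤ wildVal K a e (algebraMap _ _ p) :=
  nonneg_of_mem_valueMonoid (wildVal_mem he he0 hp)

lemma wildVal_X_pos (i : Fin 5) :
    0 < wildVal K a e (algebraMap (MvPolynomial (Fin 5) K) _ (X i)) := by
  rw [wildVal_algebraMap, aeval_X]
  fin_cases i
  · refine lt_of_fst_lt ?_
    have : (gens K a e 0).order = lexPair 1 0 := order_mono _ _
    simp [this]
  · refine lt_of_fst_lt ?_
    have : (gens K a e 1).order = lexPair (1 * expo 0) (a 0) := (order_wildTail one_pos a 0).2
    simp [this, expo_pos]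
  · refine lt_of_fst_lt ?_
    have : (gens K a e 2).order = lexPair (Real.sqrt 2) 0 := order_mono _ _
    simp [this]
  · refine lt_of_fst_lt ?_
    have : (gens K a e 3).order = lexPair (Real.sqrt 2 * expo 0) (e 0) :=
      (order_wildTail sqrt_two_pos e 0).2
    simp [this, expo_pos]
  · refine (lex_lt_iff _ _).2 (Or.inr ?_)
    have : (gens K a e 4).order = lexPair 0 1 := order_mono _ _
    simp [this]

lemma wildVal_pos_of_mem (he : Monotone e) (he0 : ∀ j, 0 ≤ e j) {p : MvPolynomial (Fin 5) K}
    (hp : p ∈ mxyuvz K) (hp0 : p ≠ 0) : 0 < wildVal K a e (algebraMap _ _ p) := by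
  induction hp using Submodule.span_induction with
  | mem x hx =>
    simp only [Set.mem_insert_iff, Set.mem_singleton_iff] at hx
    rcases hx with rfl | rfl | rfl | rfl | rfl <;> exact wildVal_X_pos _
  | zero => exact (hp0 rfl).elim
  | add x y _ _ hx hy =>
    by_cases hx0 : x = 0
    · subst hx0; simpa using hy (by simpa using hp0)
    by_cases hy0 : y = 0
    · subst hy0; simpa using hx hx0
    rw [map_add]
    refine (lt_min (hx hx0) (hy hy0)).trans_le (wildVal_add _ _ ?_)
    rw [← map_add]; exact algebraMap_ne_zero hp0
  | smul c x _ hx =>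
    have hc0 : c ≠ 0 := left_ne_zero_of_mul hp0
    have hx0 : x ≠ 0 := right_ne_zero_of_mul hp0
    rw [smul_eq_mul, map_mul, wildVal_mul _ _ (algebraMap_ne_zero hc0) (algebraMap_ne_zero hx0)]
    exact add_pos_of_nonneg_of_pos (wildVal_nonneg he he0 hc0) (hx hx0)

lemma ne_zero_of_notMem {p : MvPolynomial (Fin 5) K} (hp : p ∉ mxyuvz K) : p ≠ 0 := by
  rintro rfl; exact hp (zero_mem _)

lemma wildVal_eq_zero_of_notMem (he : Monotone e) (he0 : ∀ j, 0 ≤ e j)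
    {p : MvPolynomial (Fin 5) K} (hp : p ∉ mxyuvz K) :
    wildVal K a e (algebraMap _ _ p) = 0 := by
  by_contra hne
  have hp0 := ne_zero_of_notMem hp
  have hpos := lt_of_le_of_ne (wildVal_nonneg (a := a) he he0 hp0) (Ne.symm hne)
  have hm := sub_C_constantCoeff_mem p
  have hc : constantCoeff p ≠ 0 := fun h => by
    rw [h, map_zero, sub_zero] at hm; exact hp hm
  obtain ⟨h1, h2⟩ := order_C hc (t := gens K a e)
  have hC0 : C (constantCoeff p) ≠ 0 := fun h => h1 (by rw [h, map_zero])
  by_cases h : C (constantCoeff p) - p = 0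
  · rw [sub_eq_zero] at h
    rw [wildVal_algebraMap, ← h, h2] at hpos
    exact lt_irrefl _ hpos
  · have h3 : C (constantCoeff p) - p ∈ mxyuvz K := by
      rw [← neg_sub]; exact neg_mem hm
    have h4 := wildVal_pos_of_mem (a := a) he he0 h3 h
    have e1 : algebraMap _ (FractionRing (MvPolynomial (Fin 5) K)) p +
        algebraMap _ _ (C (constantCoeff p) - p) =
          algebraMap (MvPolynomial (Fin 5) K) _ (C (constantCoeff p)) := by
      rw [← map_add, add_sub_cancel]
    have h5 := wildVal_add (a := a) (e := e) (algebraMap _ _ p)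
      (algebraMap _ _ (C (constantCoeff p) - p)) (by rw [e1]; exact algebraMap_ne_zero hC0)
    rw [e1, wildVal_algebraMap (C _), h2] at h5
    exact absurd h5 (not_le.2 (lt_min hpos h4))

/-- Transfer of key polynomials to the rational function field. -/
lemma wildVal_rename (v : Fin 3 → Fin 5) (P : MvPolynomial (Fin 3) K) {γ : LexGroup}
    (h0 : aeval (gens K a e ∘ v) P ≠ 0) (h : (aeval (gens K a e ∘ v) P).order = γ) :
    rename v P ≠ 0 ∧ wildVal K a e (algebraMap _ _ (rename v P)) = γ := by
  rw [wildVal_algebraMap, aeval_rename]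
  refine ⟨fun h' => h0 ?_, h⟩
  rw [← aeval_rename, h', map_zero]

lemma exists_inv_two_pow_mem {D : AddSubgroup ℝ} (h1 : (1 : ℝ) ∈ D) {j : ℕ} {r : ℝ} (hr : r ∈ D)
    (hlev : IsLevel j r) : ∃ u, j ≤ u ∧ 1 / 2 ^ u ∈ D := by
  obtain ⟨s, -, hs⟩ := denom_eq_two_pow (j + 1)
  obtain ⟨j', hj', hs'⟩ := denom_eq_two_pow j
  obtain ⟨N, hN⟩ := hlev.mem
  rw [hs] at hN
  obtain ⟨t, hts, ht⟩ := (Nat.dvd_prime_pow Nat.prime_two).1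
    (Int.gcd_dvd_natAbs_right N (2 ^ s) |>.trans
    (by rw [Int.natAbs_pow]; exact dvd_rfl) : Int.gcd N (2 ^ s) ∣ 2 ^ s)
  have hbez := Int.gcd_eq_gcd_ab N (2 ^ s)
  rw [ht] at hbez
  have hts' : t + j' < s := by
    by_contra hcon
    apply hlev.notMem
    obtain ⟨N', hN'⟩ : (2 ^ t : ℤ) ∣ N := by
      have := Int.gcd_dvd_left N (2 ^ s)
      rw [ht] at this
      exact_mod_cast this
    refine ⟨N' * 2 ^ (t + j' - s), ?_⟩
    rw [hN, hs', hN']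
    push_cast
    rw [div_eq_div_iff (by positivity) (by positivity)]
    have : (2 : ℝ) ^ t * 2 ^ j' = 2 ^ (t + j' - s) * 2 ^ s := by
      rw [← pow_add, ← pow_add]; congr 1; omega
    linear_combination (N' : ℝ) * this
  refine ⟨s - t, by omega, ?_⟩
  have e : (1 : ℝ) / 2 ^ (s - t) = (N.gcdA (2 ^ s)) • r + (N.gcdB (2 ^ s)) • (1 : ℝ) := by
    have h2 : (2 : ℝ) ^ s = 2 ^ (s - t) * 2 ^ t := by rw [← pow_add]; congr 1; omega
    have h3 : (2 : ℝ) ^ t = N * N.gcdA (2 ^ s) + 2 ^ s * N.gcdB (2 ^ s) := by exact_mod_cast hbez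
    rw [hN, zsmul_eq_mul, zsmul_eq_mul]
    push_cast
    have h4 : (1 : ℝ) / 2 ^ (s - t) = 2 ^ t / 2 ^ s := by
      rw [h2]; field_simp
    rw [h4, h3]
    field_simp
  rw [e]
  exact add_mem (zsmul_mem hr _) (zsmul_mem h1 _)

lemma dyadic_le_of_isLevel {D : AddSubgroup ℝ} (h1 : (1 : ℝ) ∈ D)
    (h : ∀ j, ∃ r ∈ D, IsLevel j r) : dyadic ≤ D := by
  rintro _ ⟨k, n, rfl⟩
  obtain ⟨r, hr, hlev⟩ := h k
  obtain ⟨u, hu, hmem⟩ := exists_inv_two_pow_mem h1 hr hlev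
  have : (n : ℝ) / (2 ^ k : ℕ) = (n * 2 ^ (u - k) : ℤ) • (1 / 2 ^ u : ℝ) := by
    rw [zsmul_eq_mul]
    push_cast
    have : (2 : ℝ) ^ u = 2 ^ (u - k) * 2 ^ k := by rw [← pow_add]; congr 1; omega
    rw [this]
    field_simp
  rw [this]
  exact zsmul_mem hmem _

end Polynomial

section Main

variable {K : Type*} [Field K] {a e : ℕ → ℤ}

lemma gens_comp_fst : gens K a e ∘ ![0, 1, 4] =
    ![mono K 1 0, wildTail K one_pos a 0, mono K 0 1] := by
  funext i; fin_cases i <;> rfl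

lemma gens_comp_snd : gens K a e ∘ ![2, 3, 4] =
    ![mono K (Real.sqrt 2) 0, wildTail K sqrt_two_pos e 0, mono K 0 1] := by
  funext i; fin_cases i <;> rfl

lemma wildVal_X (i : Fin 5) :
    wildVal K a e (algebraMap (MvPolynomial (Fin 5) K) _ (X i)) = (gens K a e i).order := by
  rw [wildVal_algebraMap, aeval_X]

/-- The value group of `wildVal`. -/
noncomputable def valueGroup (K : Type*) [Field K] (a e : ℕ → ℤ) : AddSubgroup LexGroup where
  carrier := {γ | ∃ x, x ≠ 0 ∧ wildVal K a e x = γ}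
  zero_mem' := ⟨1, one_ne_zero, by rw [wildVal, map_one, HahnSeries.order_one]⟩
  add_mem' := by
    rintro _ _ ⟨x, hx, rfl⟩ ⟨y, hy, rfl⟩
    exact ⟨x * y, mul_ne_zero hx hy, wildVal_mul x y hx hy⟩
  neg_mem' := by
    rintro _ ⟨x, hx, rfl⟩
    refine ⟨x⁻¹, inv_ne_zero hx, eq_neg_of_add_eq_zero_left ?_⟩
    rw [← wildVal_mul _ _ (inv_ne_zero hx) hx, inv_mul_cancel₀ hx, wildVal, map_one,
      HahnSeries.order_one]

lemma wildVal_mem_valueGroup {p : MvPolynomial (Fin 5) K} (hp : p ≠ 0) :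
    wildVal K a e (algebraMap _ _ p) ∈ valueGroup K a e :=
  ⟨_, algebraMap_ne_zero hp, rfl⟩

/-- The real numbers `d` such that `θ * d` is the first coordinate of a value. -/
noncomputable def fstCoeffs (K : Type*) [Field K] (a e : ℕ → ℤ) (θ : ℝ) : AddSubgroup ℝ where
  carrier := {d | ∃ c, lexPair (θ * d) c ∈ valueGroup K a e}
  zero_mem' := ⟨0, by rw [mul_zero]; exact zero_mem _⟩
  add_mem' := by
    rintro d d' ⟨c, hc⟩ ⟨c', hc'⟩
    refine ⟨c + c', ?_⟩
    rw [mul_add, ← lexPair_add]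
    exact add_mem hc hc'
  neg_mem' := by
    rintro d ⟨c, hc⟩
    refine ⟨-c, ?_⟩
    rw [mul_neg]
    exact neg_mem hc

lemma dyadic_le_fstCoeffs {θ : ℝ} {t : HahnSeries LexGroup K} (ht : HasKeys θ t)
    (v : Fin 3 → Fin 5) (hv : gens K a e ∘ v = ![mono K θ 0, t, mono K 0 1]) :
    dyadic ≤ fstCoeffs K a e θ := by
  refine dyadic_le_of_isLevel ⟨0, ?_⟩ fun j => ?_
  · have h1 : gens K a e (v 0) = mono K θ 0 := congrFun hv 0
    have h2 := wildVal_mem_valueGroup (a := a) (e := e) (X_ne_zero (R := K) (v 0))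
    rwa [wildVal_X, h1, order_mono, ← mul_one θ] at h2
  · obtain ⟨P, r, c, hlev, h0, h⟩ := ht j
    rw [← hv] at h0 h
    obtain ⟨h3, h4⟩ := wildVal_rename v P h0 h
    exact ⟨r, ⟨c, h4 ▸ wildVal_mem_valueGroup h3⟩, hlev⟩

lemma isVal_wildVal (he : Monotone e) (he0 : ∀ j, 0 ≤ e j) : IsVal (wildVal K a e) where
  mul := wildVal_mul
  add x y _ _ hxy := wildVal_add x y hxy
  range γ := by
    constructor
    · rintro ⟨x, hx, rfl⟩
      obtain ⟨p, q, hq, rfl⟩ := IsFractionRing.div_surjective (A := MvPolynomial (Fin 5) K) x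
      have hq0 : q ≠ 0 := nonZeroDivisors.ne_zero hq
      have hp0 : p ≠ 0 := by rintro rfl; simp at hx
      have h1 := wildVal_mul (a := a) (e := e) _ _ hx (algebraMap_ne_zero hq0)
      rw [div_mul_cancel₀ _ (algebraMap_ne_zero hq0)] at h1
      obtain ⟨p1, hp1, q1, hq1, -, -, e1, -⟩ :=
        mem_valueMonoid.1 (wildVal_mem (a := a) he he0 hp0)
      obtain ⟨p2, hp2, q2, hq2, -, -, e2, -⟩ :=
        mem_valueMonoid.1 (wildVal_mem (a := a) he he0 hq0)
      have h2 := congrArg (fun γ => (ofLex γ).1) h1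
      simp only [fst_add, e1, e2] at h2
      refine mem_dyadicSqrt2Set.2 ⟨p1 - p2, sub_mem hp1 hp2, q1 - q2, sub_mem hq1 hq2, ?_⟩
      linarith
    · intro hγ
      obtain ⟨p, hp, q, hq, e1⟩ := mem_dyadicSqrt2Set.1 hγ
      obtain ⟨c, hc⟩ := dyadic_le_fstCoeffs (a := a) (e := e) (hasKeys_wildTail (K := K) one_pos a)
        _ gens_comp_fst hp
      obtain ⟨d, hd⟩ := dyadic_le_fstCoeffs (a := a) (e := e)
        (hasKeys_wildTail (K := K) sqrt_two_pos e) _ gens_comp_snd hq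
      have hz : lexPair 0 1 ∈ valueGroup K a e := by
        have h2 := wildVal_mem_valueGroup (a := a) (e := e) (X_ne_zero (R := K) (4 : Fin 5))
        rwa [wildVal_X, show gens K a e 4 = mono K 0 1 from rfl, order_mono] at h2
      have hz' : ∀ k : ℤ, lexPair 0 k ∈ valueGroup K a e := fun k => by
        have h2 := zsmul_mem hz k
        have h3 : k • lexPair 0 1 = lexPair 0 k :=
          lex_ext (show k • (0 : ℝ) = 0 by simp) (show k • (1 : ℤ) = k by simp)
        rwa [h3] at h2
      have h4 := add_mem (add_mem hc hd) (hz' ((ofLex γ).2 - c - d))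
      rw [lexPair_add, lexPair_add] at h4
      have h5 : lexPair (1 * p + Real.sqrt 2 * q + 0) (c + d + ((ofLex γ).2 - c - d)) = γ :=
        lex_ext (by rw [fst_lexPair, e1]; ring) (by rw [snd_lexPair]; ring)
      rwa [h5] at h4

lemma exists_level_of_le {C n : ℕ} (h : C * valueBound C < n) :
    ∃ j, C ≤ j ∧ C * valueBound j < n ∧ n ≤ j * valueBound (j + 1) := by
  have hCn : C ≤ n := by
    rcases Nat.eq_zero_or_pos (valueBound C) with h0 | h0
    · exact absurd (lt_valueBound C) (by omega)
    · exact (Nat.le_mul_of_pos_right C h0).trans h.le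
  refine ⟨Nat.findGreatest (fun j => C * valueBound j < n) n, ?_, ?_, ?_⟩
  · exact Nat.le_findGreatest hCn h
  · exact Nat.findGreatest_spec (P := fun j => C * valueBound j < n) hCn h
  · set j := Nat.findGreatest (fun j => C * valueBound j < n) n with hj
    have hCj : C ≤ j := Nat.le_findGreatest hCn h
    rcases Nat.lt_or_ge n (j + 1) with h1 | h1
    · have h2 := lt_valueBound (j + 1)
      have h3 : j ≤ n := Nat.findGreatest_le n
      rcases Nat.eq_zero_or_pos j with h4 | h4
      · omega
      · nlinarith
    · have h2 := Nat.findGreatest_is_greatest (P := fun j => C * valueBound j < n)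
        (show Nat.findGreatest (fun j => C * valueBound j < n) n < j + 1 by omega) h1
      exact (not_lt.1 h2).trans (Nat.mul_le_mul_right _ hCj)

lemma algebraMap_mem_Rxyuvz (p : MvPolynomial (Fin 5) K) : algebraMap _ _ p ∈ Rxyuvz K := by
  refine ⟨p, 1, fun h => ?_, by rw [map_one, mul_one]⟩
  have h1 := wildVal_pos_of_mem (K := K) (a := 0) (e := 0) monotone_const (fun _ => le_rfl) h
    one_ne_zero
  rw [map_one, wildVal, map_one, HahnSeries.order_one] at h1
  exact lt_irrefl _ h1

end Main

section Main

variable {K : Type*} [Field K] {a e : ℕ → ℤ} {ω : FractionRing (MvPolynomial (Fin 5) K) → LexGroup}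

lemma exists_polynomial_of_mem_Rxyuvz (hω : IsVal ω)
    (h0 : ∀ q, q ∉ mxyuvz K → ω (algebraMap _ _ q) = 0)
    {x : FractionRing (MvPolynomial (Fin 5) K)} (hx : x ∈ Rxyuvz K) (hx0 : x ≠ 0) :
    ∃ p : MvPolynomial (Fin 5) K, p ≠ 0 ∧ ω (algebraMap _ _ p) = ω x := by
  obtain ⟨p, q, hq, h⟩ := hx
  have hq0 := algebraMap_ne_zero (ne_zero_of_notMem hq)
  refine ⟨p, ?_, ?_⟩
  · rintro rfl
    rw [map_zero] at h
    exact mul_ne_zero hx0 hq0 h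
  · rw [← h, hω.mul _ _ hx0 hq0, h0 q hq, add_zero]

lemma wildVal_nonneg_of_mem_Rxyuvz (he : Monotone e) (he0 : ∀ j, 0 ≤ e j)
    {x : FractionRing (MvPolynomial (Fin 5) K)} (hx : x ∈ Rxyuvz K) (hx0 : x ≠ 0) :
    0 ≤ wildVal K a e x := by
  obtain ⟨p, hp, h⟩ := exists_polynomial_of_mem_Rxyuvz (isVal_wildVal (a := a) he he0)
    (fun q hq => wildVal_eq_zero_of_notMem he he0 hq) hx hx0
  exact h ▸ wildVal_nonneg he he0 hp

lemma wildVal_pos_of_mem_mRxyuvz (he : Monotone e) (he0 : ∀ j, 0 ≤ e j)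
    {x : FractionRing (MvPolynomial (Fin 5) K)} (hx : x ∈ mRxyuvz K) (hx0 : x ≠ 0) :
    0 < wildVal K a e x := by
  obtain ⟨p, q, hp, hq, h⟩ := hx
  have hq0 := algebraMap_ne_zero (ne_zero_of_notMem hq)
  have hp0 : p ≠ 0 := by
    rintro rfl
    rw [map_zero] at h
    exact mul_ne_zero hx0 hq0 h
  have h1 := wildVal_pos_of_mem (a := a) he he0 hp hp0
  rwa [← h, wildVal_mul _ _ hx0 hq0, wildVal_eq_zero_of_notMem he he0 hq, add_zero] at h1

lemma mem_mRxyuvz_of_wildVal_pos (he : Monotone e) (he0 : ∀ j, 0 ≤ e j)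
    {x : FractionRing (MvPolynomial (Fin 5) K)} (hx : x ∈ Rxyuvz K) (hx0 : x ≠ 0)
    (hpos : 0 < wildVal K a e x) : x ∈ mRxyuvz K := by
  obtain ⟨p, q, hq, h⟩ := hx
  refine ⟨p, q, ?_, hq, h⟩
  by_contra hp
  have hq0 := algebraMap_ne_zero (ne_zero_of_notMem hq)
  have h1 := wildVal_eq_zero_of_notMem (a := a) he he0 hp
  rw [← h, wildVal_mul _ _ hx0 hq0, wildVal_eq_zero_of_notMem he he0 hq, add_zero] at h1
  exact hpos.ne' h1

lemma exists_isLeast_of_equivalent (he : Monotone e) (he0 : ∀ j, 0 ≤ e j) (hω : IsVal ω)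
    (h : ∀ x, x ≠ 0 → (0 ≤ wildVal K a e x ↔ 0 ≤ ω x)) {p : MvPolynomial (Fin 5) K} (hp : p ≠ 0) :
    ∃ lt, IsLeast {γ : LexGroup | ∃ x : FractionRing (MvPolynomial (Fin 5) K), x ∈ Rxyuvz K ∧
      x ≠ 0 ∧ (ofLex (ω x)).1 = (ofLex (ω (algebraMap _ _ p))).1 ∧ ω x = γ} lt := by
  refine hω.exists_isLeast (A := MvPolynomial (Fin 5) K)
    (fun q hq => (h _ (algebraMap_ne_zero hq)).1 (wildVal_nonneg he he0 hq)) _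
    ⟨_, _, algebraMap_mem_Rxyuvz p, algebraMap_ne_zero hp, rfl, rfl⟩ ?_
  rintro _ ⟨x, hx, hx0, -, rfl⟩
  refine exists_polynomial_of_mem_Rxyuvz hω (fun q hq => ?_) hx hx0
  have h0 := wildVal_eq_zero_of_notMem (a := a) he he0 hq
  rw [IsVal.eq_of_fst_eq_zero (isVal_wildVal he he0) hω h
    (algebraMap_ne_zero (ne_zero_of_notMem hq)) (by rw [h0, fst_zero]), h0]

lemma fst_bounds_of_isLevel (he : Monotone e) (he0 : ∀ j, 0 ≤ e j) (hω : IsVal ω)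
    (h : ∀ x, x ≠ 0 → (0 ≤ wildVal K a e x ↔ 0 ≤ ω x)) {p : MvPolynomial (Fin 5) K} (hp : p ≠ 0)
    {θ r : ℝ} {c : ℤ} {j : ℕ} (hθ : θ ≤ 2) (hr : IsLevel j r)
    (hpr : wildVal K a e (algebraMap _ _ p) = lexPair (θ * r) c) :
    0 ≤ (ofLex (ω (algebraMap _ _ p))).1 ∧ (ofLex (ω (algebraMap _ _ p))).1 ≤
      valueBound j * (ofLex (ω (algebraMap _ _ (X 0 : MvPolynomial (Fin 5) K)))).1 := by
  constructor
  · exact fst_le_of_le ((h _ (algebraMap_ne_zero hp)).1 (wildVal_nonneg he he0 hp))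
  · refine IsVal.fst_le_of_lt (isVal_wildVal he he0) hω h (algebraMap_ne_zero hp)
      (algebraMap_ne_zero (X_ne_zero 0)) ?_
    rw [hpr, wildVal_X, show gens K a e 0 = mono K 1 0 from rfl, order_mono, fst_lexPair,
      fst_lexPair, mul_one]
    exact (mul_le_mul_of_nonneg_right hθ hr.nonneg).trans_lt hr.lt

/-- The wild behaviour of the minimal values, for valuations equivalent to `wildVal`. -/
lemma exists_wild_values {f g : ℕ → ℤ} (hf : Antitone f) (hg : Monotone g)
    (he : Monotone e) (he0 : ∀ j, 0 ≤ e j) (heg : ∀ j, g (j * valueBound (j + 1)) < e j)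
    (haf : ∀ j, ∃ (p : MvPolynomial (Fin 5) K) (r : ℝ) (c : ℤ), p ≠ 0 ∧ IsLevel j r ∧
      c < f (j * valueBound (j + 1)) ∧ wildVal K a e (algebraMap _ _ p) = lexPair (1 * r) c)
    (hω : IsVal ω) (h : ∀ x, x ≠ 0 → (0 ≤ wildVal K a e x ↔ 0 ≤ ω x)) :
    ∃ n₀ : ℕ, ∀ n : ℕ, n₀ ≤ n → ∀ P : LexGroup → Prop,
      (P = (fun γ => (ofLex γ).2 < f n) ∨ P = fun γ => g n < (ofLex γ).2) →
      ∃ lam : ℝ,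
        (∃ x : FractionRing (MvPolynomial (Fin 5) K),
          x ∈ Rxyuvz K ∧ x ≠ 0 ∧ (ofLex (ω x)).1 = lam) ∧
        0 ≤ lam ∧ lam < (n : ℝ) ∧
        ∃ lt : LexGroup,
          IsLeast {γ : LexGroup | ∃ x : FractionRing (MvPolynomial (Fin 5) K),
            x ∈ Rxyuvz K ∧ x ≠ 0 ∧ (ofLex (ω x)).1 = lam ∧ ω x = γ} lt ∧ P lt := by
  have hν := isVal_wildVal (K := K) (a := a) he he0
  obtain ⟨C, hC⟩ := exists_nat_gt (ofLex (ω (algebraMap _ _ (X 0 : MvPolynomial (Fin 5) K)))).1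
  refine ⟨C * valueBound C + 1, fun n hn P hP => ?_⟩
  obtain ⟨j, -, hjn, hnj⟩ := exists_level_of_le (Nat.lt_of_succ_le hn)
  have key : ∀ (θ r : ℝ) (c : ℤ) (p : MvPolynomial (Fin 5) K), p ≠ 0 → θ ≤ 2 → IsLevel j r →
      wildVal K a e (algebraMap _ _ p) = lexPair (θ * r) c →
      0 ≤ (ofLex (ω (algebraMap _ _ p))).1 ∧ (ofLex (ω (algebraMap _ _ p))).1 < n := by
    intro θ r c p hp hθ hr hpr
    obtain ⟨h1, h2⟩ := fst_bounds_of_isLevel he he0 hω h hp hθ hr hpr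
    refine ⟨h1, h2.trans_lt (lt_of_le_of_lt ?_ (Nat.cast_lt.2 hjn))⟩
    rw [mul_comm C, Nat.cast_mul]
    exact mul_le_mul_of_nonneg_left hC.le (Nat.cast_nonneg _)
  rcases hP with rfl | rfl
  · obtain ⟨p, r, c, hp, hr, hc, hpr⟩ := haf j
    obtain ⟨h1, h2⟩ := key 1 r c p hp (by norm_num) hr hpr
    obtain ⟨lt, hlt⟩ := exists_isLeast_of_equivalent (p := p) he he0 hω h hp
    have hp' := algebraMap_ne_zero hp
    refine ⟨_, ⟨_, algebraMap_mem_Rxyuvz p, hp', rfl⟩, h1, h2, lt, hlt, ?_⟩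
    obtain ⟨x, -, -, hx, rfl⟩ := hlt.1
    have h3 := hlt.2 ⟨_, algebraMap_mem_Rxyuvz p, hp', rfl, rfl⟩
    rw [lex_le_iff] at h3
    have h4 := (h3.resolve_left hx.not_lt).2
    rw [IsVal.snd_eq hν hω h hp', hpr, snd_lexPair] at h4
    exact (h4.trans_lt hc).trans_le (hf hnj)
  · obtain ⟨P, r, c, hr, h0, hPr⟩ := hasKeys_wildTail (K := K) sqrt_two_pos e j
    rw [← gens_comp_snd (a := a)] at h0 hPr
    obtain ⟨hp, hpr⟩ := wildVal_rename _ P h0 hPr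
    have hs : Real.sqrt 2 ≤ 2 := by
      rw [Real.sqrt_le_left (by norm_num)]; norm_num
    obtain ⟨h1, h2⟩ := key _ r c _ hp hs hr hpr
    obtain ⟨lt, hlt⟩ := exists_isLeast_of_equivalent he he0 hω h hp
    have hp' := algebraMap_ne_zero hp
    refine ⟨_, ⟨_, algebraMap_mem_Rxyuvz _, hp', rfl⟩, h1, h2, lt, hlt, ?_⟩
    obtain ⟨x, hxR, hx0, hx, rfl⟩ := hlt.1
    have h3 := IsVal.fst_eq_of_fst_eq hω hν (fun y hy => (h y hy).symm) hx0 hp' hx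
    rw [hpr, fst_lexPair] at h3
    obtain ⟨q, hq, hqx⟩ := exists_polynomial_of_mem_Rxyuvz hν
      (fun q hq => wildVal_eq_zero_of_notMem he he0 hq) hxR hx0
    have h4 := wildVal_mem (a := a) he he0 hq
    rw [hqx] at h4
    have h5 := le_snd_of_mem_valueMonoid h4 (grid_denom_le_dyadic _ hr.mem)
      (by rw [h3, mul_comm]) hr.notMem
    rw [← IsVal.snd_eq hν hω h hx0] at h5
    exact ((hg hnj).trans_lt (heg j)).trans_le h5

end Main

end WildValuation

/-- **Example 4 of the paper.**  Given a nonincreasing `f : ℕ → ℤ` and a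
nondecreasing `g : ℕ → ℤ`, there is a valuation `ν` of `K(x,y,u,v,z)` with value group exactly
`H × ℤ` (`H = ℤ[1/2] + ℤ[1/2]√2 ⊆ ℝ`), lexicographically ordered, dominating
`R = K[x,y,u,v,z]_{(x,y,u,v,z)}`, such that for every equivalent valuation `ω` with value
group `H × ℤ` there is `n₀` such that for all `n ≥ n₀` there are `λ₁, λ₂ ∈ ω₂(R∖{0}) ∩ [0, n)`
with `π₂(λ̃₁) < f(n)` and `π₂(λ̃₂) > g(n)`. -/
theorem stmt19 (K : Type*) [Field K] (f g : ℕ → ℤ)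
    (hf : ∀ m n : ℕ, n ≤ m → f m ≤ f n) (hg : ∀ m n : ℕ, n ≤ m → g n ≤ g m) :
    ∃ ν : FractionRing (MvPolynomial (Fin 5) K) → ℝ ×ₗ ℤ,
      (∀ x y : FractionRing (MvPolynomial (Fin 5) K), x ≠ 0 → y ≠ 0 →
        ν (x * y) = ν x + ν y) ∧
      (∀ x y : FractionRing (MvPolynomial (Fin 5) K), x ≠ 0 → y ≠ 0 → x + y ≠ 0 →
        min (ν x) (ν y) ≤ ν (x + y)) ∧
      -- the value group is exactly `H × ℤ`
      ({γ : ℝ ×ₗ ℤ | ∃ x : FractionRing (MvPolynomial (Fin 5) K), x ≠ 0 ∧ ν x = γ}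
        = {γ : ℝ ×ₗ ℤ | (ofLex γ).1 ∈ dyadicSqrt2Set}) ∧
      -- `ν` dominates `R`
      (∀ x ∈ Rxyuvz K, x ≠ 0 → 0 ≤ ν x) ∧
      (∀ x ∈ mRxyuvz K, x ≠ 0 → 0 < ν x) ∧
      (∀ x ∈ Rxyuvz K, x ≠ 0 → 0 < ν x → x ∈ mRxyuvz K) ∧
      -- the wild behavior of the tilde function, for any equivalent valuation
      (∀ ω : FractionRing (MvPolynomial (Fin 5) K) → ℝ ×ₗ ℤ,
        (∀ x y : FractionRing (MvPolynomial (Fin 5) K), x ≠ 0 → y ≠ 0 →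
          ω (x * y) = ω x + ω y) →
        (∀ x y : FractionRing (MvPolynomial (Fin 5) K), x ≠ 0 → y ≠ 0 → x + y ≠ 0 →
          min (ω x) (ω y) ≤ ω (x + y)) →
        ({γ : ℝ ×ₗ ℤ | ∃ x : FractionRing (MvPolynomial (Fin 5) K), x ≠ 0 ∧ ω x = γ}
          = {γ : ℝ ×ₗ ℤ | (ofLex γ).1 ∈ dyadicSqrt2Set}) →
        -- `ω` is equivalent to `ν`: they have the same valuation ring
        ({x : FractionRing (MvPolynomial (Fin 5) K) | x = 0 ∨ 0 ≤ ν x}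
          = {x : FractionRing (MvPolynomial (Fin 5) K) | x = 0 ∨ 0 ≤ ω x}) →
        ∃ n₀ : ℕ, ∀ n : ℕ, n₀ ≤ n →
          (∃ lam : ℝ,
            (∃ h : FractionRing (MvPolynomial (Fin 5) K),
              h ∈ Rxyuvz K ∧ h ≠ 0 ∧ (ofLex (ω h)).1 = lam) ∧
            0 ≤ lam ∧ lam < (n : ℝ) ∧
            ∃ lt : ℝ ×ₗ ℤ,
              IsLeast {γ : ℝ ×ₗ ℤ | ∃ h : FractionRing (MvPolynomial (Fin 5) K),
                h ∈ Rxyuvz K ∧ h ≠ 0 ∧ (ofLex (ω h)).1 = lam ∧ ω h = γ} lt ∧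
              (ofLex lt).2 < f n) ∧
          (∃ lam : ℝ,
            (∃ h : FractionRing (MvPolynomial (Fin 5) K),
              h ∈ Rxyuvz K ∧ h ≠ 0 ∧ (ofLex (ω h)).1 = lam) ∧
            0 ≤ lam ∧ lam < (n : ℝ) ∧
            ∃ lt : ℝ ×ₗ ℤ,
              IsLeast {γ : ℝ ×ₗ ℤ | ∃ h : FractionRing (MvPolynomial (Fin 5) K),
                h ∈ Rxyuvz K ∧ h ≠ 0 ∧ (ofLex (ω h)).1 = lam ∧ ω h = γ} lt ∧
              g n < (ofLex lt).2)) := by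
  obtain ⟨a, ha⟩ := WildValuation.exists_negative_seq K one_pos
    (fun j => f (j * WildValuation.valueBound (j + 1)))
  set e : ℕ → ℤ := fun j => max 0 (g (j * WildValuation.valueBound (j + 1)) + 1)
  have he0 : ∀ j, 0 ≤ e j := fun j => le_max_left _ _
  have hg' : Monotone g := fun m n h => hg n m h
  have hf' : Antitone f := fun m n h => hf n m h
  have he : Monotone e := fun i j hij => max_le_max le_rfl <| by
    gcongr
    exact hg' (Nat.mul_le_mul hij (WildValuation.valueBound_mono (Nat.succ_le_succ hij)))
  have heg : ∀ j, g (j * WildValuation.valueBound (j + 1)) < e j := fun j =>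
    (lt_add_one _).trans_le (le_max_right _ _)
  refine ⟨WildValuation.wildVal K a e, WildValuation.wildVal_mul,
    fun x y _ _ => WildValuation.wildVal_add x y,
    Set.ext (WildValuation.isVal_wildVal he he0).range,
    fun x => WildValuation.wildVal_nonneg_of_mem_Rxyuvz he he0,
    fun x => WildValuation.wildVal_pos_of_mem_mRxyuvz he he0,
    fun x => WildValuation.mem_mRxyuvz_of_wildVal_pos he he0, ?_⟩
  intro ω hmul hadd hrange hring
  obtain ⟨n₀, hn₀⟩ := WildValuation.exists_wild_values (a := a) hf' hg' he he0 heg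
    (fun j => by
      obtain ⟨P, r, c, hr, hc, h0, h⟩ := ha j
      rw [← WildValuation.gens_comp_fst (e := e)] at h0 h
      obtain ⟨h1, h2⟩ := WildValuation.wildVal_rename _ P h0 h
      exact ⟨_, r, c, h1, hr, hc, h2⟩)
    ⟨hmul, hadd, fun γ => Set.ext_iff.1 hrange γ⟩
    (fun x hx => by simpa [hx] using Set.ext_iff.1 hring x)
  exact ⟨n₀, fun n hn => ⟨hn₀ n hn _ (Or.inl rfl), hn₀ n hn _ (Or.inr rfl)⟩⟩
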